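/- Fix an integer r ≥ 2. For every n ≥ 4, the element x_{3−n} of ℚ(x_1,x_2) satisfies x_{3−n} = x_2^{−c_{n−1}} · x_1^{−c_{n−2}} · Σ_{β ∈ F(D_n)} x_2^{r·|β|_1} · x_1^{r·(c_{n−1}−|β|_2)}. -/

import Mathlib

open scoped Classical

namespace CF

noncomputable section

/-- The sequence `c` : `c 1 = 0`, `c 2 = 1`, `c n = r * c (n-1) - c (n-2)`.
(The value `c 0 = -1` is the unique value consistent with the recurrence.) -/
def c (r : ℕ) : ℕ → ℤ
  | 0 => -1
  | 1 => 0
  | n + 2 => (r : ℤ) * c r (n + 1) - c r n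

/-- `c` as a natural number (valid for indices `≥ 1` when `r ≥ 2`). -/
def cN (r n : ℕ) : ℕ := (c r n).toNat

/-- Height (y-coordinate) of the vertex `w_k` of the maximal Dyck path `D_n`:
the maximal Dyck path from `(0,0)` to `(c_{n-1}-c_{n-2}, c_{n-2})` weakly below the
diagonal has `w_k = (k - ⌊k·c_{n-2}/c_{n-1}⌋, ⌊k·c_{n-2}/c_{n-1}⌋)`. -/
def hgt (r n k : ℕ) : ℕ := k * cN r (n - 2) / cN r (n - 1)

/-- The edge `α_j` of `D_n` is vertical (a north step). -/
def isVert (r n j : ℕ) : Prop := hgt r n (j - 1) < hgt r n j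

/-- Index in the vertex sequence `w_0, …, w_{c_{n-1}}` of the vertex `v_j`
(the upper endpoint of the `j`-th vertical edge); `vpos r n 0 = 0`. -/
def vpos (r n j : ℕ) : ℕ := (j * cN r (n - 1) + cN r (n - 2) - 1) / cN r (n - 2)

/-- x-coordinate of the vertex `v_j` of `D_n` (its y-coordinate is `j`). -/
def vx (r n j : ℕ) : ℤ := (vpos r n j : ℤ) - (j : ℤ)

/-- The slope `s_{i,t}` between `v_i` and `v_t` is at most the slope `s` of the diagonal,
expressed by cross-multiplication. -/
def slopeLE (r n i t : ℕ) : Prop :=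
  ((t : ℤ) - (i : ℤ)) * (c r (n - 1) - c r (n - 2)) ≤ (vx r n t - vx r n i) * c r (n - 2)

/-- `{t | i < t ≤ k, s_{i,t} > s}`. -/
def badSet (r n i k : ℕ) : Finset ℕ :=
  (Finset.Icc (i + 1) k).filter fun t => ¬ slopeLE r n i t

/-- `α(i,k)` is blue: `s_{i,t} ≤ s` for all `i < t ≤ k`. -/
def isBlue (r n i k : ℕ) : Prop := badSet r n i k = ∅

/-- `t₀` is the minimum of `{t | i < t ≤ k, s_{i,t} > s}`. -/
def minBad (r n i k t₀ : ℕ) : Prop :=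
  t₀ ∈ badSet r n i k ∧ ∀ t ∈ badSet r n i k, t₀ ≤ t

/-- `α(i,k)` is `(m,w)`-green: the minimum `t₀` of `{t | i < t ≤ k, s_{i,t} > s}` exists and
equals `i + c_m - w·c_{m-1}`, with `3 ≤ m ≤ n-2` and `1 ≤ w < r-1`. -/
def isGreenMW (r n i k m w : ℕ) : Prop :=
  3 ≤ m ∧ m + 2 ≤ n ∧ 1 ≤ w ∧ (w : ℤ) < (r : ℤ) - 1 ∧
    ∃ t₀ : ℕ, minBad r n i k t₀ ∧ (t₀ : ℤ) = (i : ℤ) + (c r m - (w : ℤ) * c r (m - 1))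

def isGreen (r n i k : ℕ) : Prop := ∃ m w, isGreenMW r n i k m w

/-- `α(i,k)` is red: neither blue nor green. -/
def isRed (r n i k : ℕ) : Prop := ¬ isBlue r n i k ∧ ¬ isGreen r n i k

/-- An element of `P(D_n)`: either a single edge `α_j` (`Sum.inl j`) or a subpath
`α(i,k)` (`Sum.inr (i,k)`). -/
abbrev Elt := ℕ ⊕ ℕ × ℕ

/-- The set of (indices of) edges of `D_n` constituting an element of `P(D_n)`:
a single edge; for `α(i,k)`, the edges from `v_i` (or from its immediate predecessor,
in the red case) to `v_k`. -/
def edges (r n : ℕ) : Elt → Finset ℕ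
  | Sum.inl j => {j}
  | Sum.inr (i, k) =>
      if isRed r n i k then Finset.Icc (vpos r n i) (vpos r n k)
      else Finset.Icc (vpos r n i + 1) (vpos r n k)

/-- Validity of an element of `P(D_n)`: `1 ≤ j ≤ c_{n-1}` for a single edge,
`0 ≤ i < k ≤ c_{n-2}` for a subpath `α(i,k)`. -/
def validElt (r n : ℕ) : Elt → Prop
  | Sum.inl j => 1 ≤ j ∧ (j : ℤ) ≤ c r (n - 1)
  | Sum.inr (i, k) => i < k ∧ (k : ℤ) ≤ c r (n - 2)

/-- The common conditions on a collection `β = {β_1,…,β_t}` of elements of `P(D_n)`: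
all elements are valid, distinct elements share no edge, and for any two subpaths
`α(i,k)`, `α(i',k')` one has `i ≠ k'` and `i' ≠ k`. -/
def validColl (r n : ℕ) (β : Finset Elt) : Prop :=
  (∀ p ∈ β, validElt r n p) ∧
  (∀ p ∈ β, ∀ q ∈ β, p ≠ q → Disjoint (edges r n p) (edges r n q)) ∧
  (∀ i k i' k' : ℕ, Sum.inr (i, k) ∈ β → Sum.inr (i', k') ∈ β → i ≠ k' ∧ i' ≠ k)

/-- The `c_{m-1} - w·c_{m-2}` edges of `D_n` immediately preceding the vertex `v_i`. -/
def precEdges (r n i m w : ℕ) : Finset ℕ :=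
  Finset.Icc (vpos r n i + 1 - (c r (m - 1) - (w : ℤ) * c r (m - 2)).toNat) (vpos r n i)

/-- The set `F(D_n)`. -/
def FD (r n : ℕ) : Set (Finset Elt) :=
  {β | validColl r n β ∧
    ∀ i k m w : ℕ, Sum.inr (i, k) ∈ β → isGreenMW r n i k m w →
      ∃ e ∈ precEdges r n i m w, ∃ p ∈ β, e ∈ edges r n p}

/-- The set `F̃(D_n)`. -/
def Ftilde (r n : ℕ) : Set (Finset Elt) := {β | validColl r n β}

/-- The set `T^{≥u}(D_n)`. -/
def Tge (r n u : ℕ) : Set (Finset Elt) :=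
  {β | validColl r n β ∧ β.Nonempty ∧
    ∃ i k m w : ℕ, u ≤ m ∧ Sum.inr (i, k) ∈ β ∧ isGreenMW r n i k m w ∧
      ∀ e ∈ precEdges r n i m w, ∀ p ∈ β, e ∉ edges r n p}

/-- `|β_j|_1` for a single element. -/
def wt1 : Elt → ℕ
  | Sum.inl _ => 0
  | Sum.inr (i, k) => k - i

/-- `|β|_1`. -/
def B1 (β : Finset Elt) : ℕ := ∑ p ∈ β, wt1 p

/-- `|β|_2`: the total number of edges in the collection `β`. -/
def B2 (r n : ℕ) (β : Finset Elt) : ℕ := (β.biUnion (edges r n)).card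

/-- The field `ℚ(x₁,x₂)`. -/
abbrev K := FractionRing (MvPolynomial (Fin 2) ℚ)

/-- The indeterminate `x₁`. -/
def x₁ : K := algebraMap (MvPolynomial (Fin 2) ℚ) K (MvPolynomial.X 0)

/-- The indeterminate `x₂`. -/
def x₂ : K := algebraMap (MvPolynomial (Fin 2) ℚ) K (MvPolynomial.X 1)

/-- `b_{n-1,k}`: `r` if the edge `α_k` of `D_n` is horizontal, `r-1` if vertical. -/
def bseq (r n k : ℕ) : ℕ := if isVert r n k then r - 1 else r

/-- Prefix sums `S e = Σ_{k=1}^{e} b_{n-1,k}`. -/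
def S (r n e : ℕ) : ℕ := ∑ k ∈ Finset.Icc 1 e, bseq r n k

/-- The interval `[a,b] ⊆ [1,c_n]` is (the edge set of) a blue or green subpath of `D_{n+1}`. -/
def isBGinterval (r n a b : ℕ) : Prop :=
  ∃ i k : ℕ, i < k ∧ (k : ℤ) ≤ c r (n - 1) ∧ ¬ isRed r (n + 1) i k ∧
    Finset.Icc a b = Finset.Icc (vpos r (n + 1) i + 1) (vpos r (n + 1) k)

/-- Left endpoints of the maximal interval components of `V`. -/
def starts (V : Finset ℕ) : Finset ℕ := V.filter fun e => e - 1 ∉ V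

/-- Right endpoint of the maximal interval component of `V` starting at `e`. -/
def compEnd (V : Finset ℕ) (e : ℕ) : ℕ := sSup {g : ℕ | Finset.Icc e g ⊆ V}

/-- `f_i(V)`: the image of the maximal interval component of `V` starting at `e`. -/
def fcomp (r n : ℕ) (V : Finset ℕ) (e : ℕ) : Finset ℕ :=
  if isBGinterval r n (S r n (e - 1) + 1) (S r n (compEnd V e)) then
    Finset.Icc (S r n (e - 1) + 1) (S r n (compEnd V e))
  else
    insert (S r n (e - 1)) (Finset.Icc (S r n (e - 1) + 1) (S r n (compEnd V e)))

/-- The map `f` from subsets of `[1,c_{n-1}]` to subsets of `[1,c_n]`. -/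
def fmap (r n : ℕ) (V : Finset ℕ) : Finset ℕ := (starts V).biUnion (fcomp r n V)

/-- The pull-back `f*` (of the map `f` one level down, from subsets of `[1,c_{n-2}]`
to subsets of `[1,c_{n-1}]`). -/
def fstar (r n : ℕ) (W : Finset ℕ) : Finset ℕ :=
  ((Finset.Icc 1 (cN r (n - 2))).powerset.filter fun U => fmap r (n - 1) U ⊆ W).biUnion id

/-- `δ` of a maximal interval component `[e,g]`: `1` if the `w`-th edge of the corresponding
subpath of `D_n` is vertical for some `2 ≤ w ≤ r-1`, and `0` otherwise. -/
def deltaComp (r n e g : ℕ) : ℕ :=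
  if ∃ w : ℕ, 2 ≤ w ∧ w ≤ r - 1 ∧ e + w - 1 ≤ g ∧ isVert r n (e + w - 1) then 1 else 0

/-- `δ_V`. -/
def deltaV (r n : ℕ) (V : Finset ℕ) : ℕ :=
  ∑ e ∈ starts V, deltaComp r n e (compEnd V e)

/-- Generalized binomial coefficient for integers `A`, `B`. -/
def gbinom (A B : ℤ) : ℚ :=
  if B < 0 then 0
  else (∏ i ∈ Finset.range B.toNat, ((A : ℚ) - (i : ℚ))) / (B.toNat.factorial : ℚ)

/-- `z_n` for `n ≥ 4`, given by the sum over `F̃(D_n)`. -/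
def zF (r n : ℕ) : K :=
  x₁ ^ (-(c r (n - 1))) * x₂ ^ (-(c r (n - 2))) *
    ∑ᶠ β ∈ Ftilde r n,
      x₁ ^ ((r : ℤ) * (B1 β : ℤ)) * x₂ ^ ((r : ℤ) * (c r (n - 1) - (B2 r n β : ℤ)))

/-- `z_n`, with `z_3 = x_3` (the value `x3` is the cluster variable `x_3`). -/
def z (r : ℕ) (x3 : K) (n : ℕ) : K := if n = 3 then x3 else zF r n

end

/-! ### Arithmetic of the sequence `c` -/

theorem c_add_two (r n : ℕ) : c r (n + 2) = (r : ℤ) * c r (n + 1) - c r n := rfl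

theorem c_one (r : ℕ) : c r 1 = 0 := rfl

theorem c_two (r : ℕ) : c r 2 = 1 := by simp [c]

theorem c_three (r : ℕ) : c r 3 = r := by rw [c_add_two, c_two, c_one]; ring

theorem c_four (r : ℕ) : c r 4 = r * r - 1 := by rw [c_add_two, c_three, c_two]

theorem c_aux (r : ℕ) (hr : 2 ≤ r) (n : ℕ) : 0 ≤ c r (n + 1) ∧ c r n < c r (n + 1) := by
  induction n with
  | zero => simp [c]
  | succ k ih =>
    obtain ⟨h1, h2⟩ := ih
    have h3 : (2 : ℤ) ≤ r := by exact_mod_cast hr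
    have h4 := c_add_two r k
    constructor <;> nlinarith

theorem c_strictMono (r : ℕ) (hr : 2 ≤ r) : StrictMono (c r) :=
  strictMono_nat_of_lt_succ fun n => (c_aux r hr n).2

theorem c_mono {r : ℕ} (hr : 2 ≤ r) {a b : ℕ} (h : a ≤ b) : c r a ≤ c r b :=
  (c_strictMono r hr).monotone h

theorem c_pos {r : ℕ} (hr : 2 ≤ r) {n : ℕ} (hn : 2 ≤ n) : 1 ≤ c r n := by
  have := c_mono hr hn
  rwa [c_two] at this

theorem c_nonneg {r : ℕ} (hr : 2 ≤ r) {n : ℕ} (hn : 1 ≤ n) : 0 ≤ c r n := by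
  have := c_mono hr hn
  rwa [c_one] at this

theorem cN_cast {r : ℕ} (hr : 2 ≤ r) {n : ℕ} (hn : 1 ≤ n) : ((cN r n : ℕ) : ℤ) = c r n :=
  Int.toNat_of_nonneg (c_nonneg hr hn)

theorem c_cross (r p q : ℕ) :
    c r (p + 1) * c r (p + q) - c r p * c r (p + q + 1) = c r (q + 1) := by
  induction p with
  | zero => simp [c]
  | succ p ih =>
    have e1 : p + 1 + q = p + q + 1 := by ring
    rw [e1]
    have h1 := c_add_two r p
    have h2 := c_add_two r (p + q)
    rw [show p + q + 1 + 1 = p + q + 2 from rfl, show p + 1 + 1 = p + 2 from rfl, h1, h2]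
    linear_combination ih

/-! ### The vertices `v_j` -/

/-- `v r n j` is the position of the vertex `v_j` of `D_{n+2}`. -/
def v (r n j : ℕ) : ℕ := vpos r (n + 2) j

/-- Defect of the vertex `v_j` of `D_{n+2}`. -/
def df (r n j : ℕ) : ℤ := (v r n j : ℤ) * c r n - (j : ℤ) * c r (n + 1)

theorem v_le_iff {r n : ℕ} (hr : 2 ≤ r) (hn : 2 ≤ n) (j y : ℕ) :
    v r n j ≤ y ↔ (j : ℤ) * c r (n + 1) ≤ (y : ℤ) * c r n := by
  have h1 := cN_cast hr (n := n) (by omega)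
  have h2 := cN_cast hr (n := n + 1) (by omega)
  have h3 := c_pos hr hn
  rw [← h1, ← h2]
  have h4 : 0 < cN r n := by
    have : (0 : ℤ) < (cN r n : ℤ) := by rw [h1]; omega
    exact_mod_cast this
  unfold v vpos
  rw [show n + 2 - 1 = n + 1 from rfl, show n + 2 - 2 = n from rfl]
  rw [← Nat.lt_succ_iff, Nat.div_lt_iff_lt_mul h4]
  norm_cast
  rw [Nat.succ_eq_add_one, add_mul]
  omega

theorem df_nonneg {r n : ℕ} (hr : 2 ≤ r) (hn : 2 ≤ n) (j : ℕ) : 0 ≤ df r n j := by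
  have := (v_le_iff hr hn j (v r n j)).1 le_rfl
  unfold df; linarith

theorem v_zero {r n : ℕ} (hr : 2 ≤ r) (hn : 2 ≤ n) : v r n 0 = 0 := by
  have := (v_le_iff hr hn 0 0).2 (by simp)
  omega

theorem df_lt {r n : ℕ} (hr : 2 ≤ r) (hn : 2 ≤ n) (j : ℕ) : df r n j < c r n := by
  have h3 := c_pos hr hn
  rcases Nat.eq_zero_or_pos (v r n j) with h | h
  · unfold df
    rw [h]
    have : 0 ≤ (j : ℤ) * c r (n + 1) :=
      mul_nonneg (by positivity) (c_nonneg hr (by omega))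
    push_cast; linarith
  · have := (v_le_iff hr hn j (v r n j - 1)).not.1 (by omega)
    rw [Nat.cast_sub (by omega)] at this
    unfold df
    push_cast at this
    linarith

theorem df_zero {r n : ℕ} (hr : 2 ≤ r) (hn : 2 ≤ n) : df r n 0 = 0 := by
  simp [df, v_zero hr hn]

theorem v_lt_succ {r n : ℕ} (hr : 2 ≤ r) (hn : 2 ≤ n) (j : ℕ) : v r n j < v r n (j + 1) := by
  by_contra h
  push Not at h
  rw [v_le_iff hr hn] at h
  have h1 := df_lt hr hn j
  have h2 := (c_strictMono r hr) (show n < n + 1 by omega)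
  unfold df at h1
  push_cast at h
  linarith

theorem v_strictMono {r n : ℕ} (hr : 2 ≤ r) (hn : 2 ≤ n) : StrictMono (v r n) :=
  strictMono_nat_of_lt_succ fun j => v_lt_succ hr hn j

theorem v_top {r n : ℕ} (hr : 2 ≤ r) (hn : 2 ≤ n) : v r n (cN r n) = cN r (n + 1) := by
  have h1 := cN_cast hr (n := n) (by omega)
  have h2 := cN_cast hr (n := n + 1) (by omega)
  have h3 := c_pos hr hn
  apply le_antisymm
  · rw [v_le_iff hr hn, h1, h2]; linarith
  · have := (v_le_iff hr hn (cN r n) (v r n (cN r n))).1 le_rfl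
    rw [h1, mul_comm] at this
    have h4 := le_of_mul_le_mul_right this (by linarith)
    rw [← h2] at h4
    exact_mod_cast h4

/-- Every position lies in a unique block. -/
theorem exists_block {r n : ℕ} (hr : 2 ≤ r) (hn : 2 ≤ n) (t : ℕ) :
    ∃ j, v r n j ≤ t ∧ t < v r n (j + 1) := by
  classical
  have hid : ∀ j, j ≤ v r n j := fun j => (v_strictMono hr hn).le_apply
  have hex : ∃ j, t < v r n (j + 1) := ⟨t, by have := hid (t + 1); omega⟩
  refine ⟨Nat.find hex, ?_, Nat.find_spec hex⟩
  rcases h : Nat.find hex with _ | k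
  · rw [v_zero hr hn]; omega
  · have := Nat.find_min hex (m := k) (by omega)
    omega

/-- Position of `v_t` in the next Dyck path. -/
theorem v_next {r n : ℕ} (hr : 2 ≤ r) (hn : 2 ≤ n) {t j : ℕ} (h1 : v r n j ≤ t)
    (h2 : t < v r n (j + 1)) : (v r (n + 1) t : ℤ) = r * t - j := by
  have a1 := (v_le_iff hr hn j t).1 h1
  have a2 := (v_le_iff hr hn (j + 1) t).not.1 (by omega)
  have h3 := c_pos hr hn
  have h5 := c_pos hr (n := n + 1) (by omega)
  have h4 := c_add_two r n
  have hjt : j ≤ t := le_trans ((v_strictMono hr hn).le_apply) h1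
  have hjt' : j ≤ r * t := le_trans hjt (Nat.le_mul_of_pos_left _ (by omega))
  push_cast at a2
  have b1 : v r (n + 1) t ≤ r * t - j := by
    rw [v_le_iff hr (by omega), Nat.cast_sub hjt']
    push_cast
    rw [h4]
    linarith
  have b2 : ¬ v r (n + 1) t + 1 ≤ r * t - j := by
    intro hb
    have := (v_le_iff hr (n := n + 1) (by omega) t (v r (n + 1) t)).1 le_rfl
    have hb' : (v r (n + 1) t : ℤ) + 1 ≤ r * t - j := by
      have : ((v r (n + 1) t + 1 : ℕ) : ℤ) ≤ ((r * t - j : ℕ) : ℤ) := by exact_mod_cast hb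
      rw [Nat.cast_sub hjt'] at this
      push_cast at this
      exact this
    rw [show n + 1 + 1 = n + 2 from rfl, h4] at this
    have := mul_le_mul_of_nonneg_right hb' (show 0 ≤ c r (n + 1) by linarith)
    nlinarith
  have : v r (n + 1) t = r * t - j := by omega
  rw [this, Nat.cast_sub hjt']
  push_cast
  ring

theorem df_next {r n : ℕ} (hr : 2 ≤ r) (hn : 2 ≤ n) {t j : ℕ} (h1 : v r n j ≤ t)
    (h2 : t < v r n (j + 1)) :
    df r (n + 1) t = df r n j + ((t : ℤ) - v r n j) * c r n := by
  unfold df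
  rw [v_next hr hn h1 h2, show n + 1 + 1 = n + 2 from rfl, c_add_two]
  ring

theorem df_next_v {r n : ℕ} (hr : 2 ≤ r) (hn : 2 ≤ n) (j : ℕ) :
    df r (n + 1) (v r n j) = df r n j := by
  rw [df_next hr hn le_rfl (v_lt_succ hr hn j)]; ring

theorem v_next_v {r n : ℕ} (hr : 2 ≤ r) (hn : 2 ≤ n) (j : ℕ) :
    (v r (n + 1) (v r n j) : ℤ) = r * v r n j - j :=
  v_next hr hn le_rfl (v_lt_succ hr hn j)

theorem v_sub_le {r n : ℕ} (hr : 2 ≤ r) (hn : 2 ≤ n) (j : ℕ) :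
    v r n (j + 1) ≤ v r n j + r := by
  rw [v_le_iff hr hn]
  have h := df_nonneg hr hn j
  unfold df at h
  have h4 : c r (n + 1) ≤ r * c r n := by
    obtain ⟨k, rfl⟩ : ∃ k, n = k + 1 := ⟨n - 1, by omega⟩
    have := c_add_two r k
    have := c_nonneg hr (n := k) (by omega)
    rw [show k + 1 + 1 = k + 2 from rfl]
    linarith
  push_cast
  linarith

/-! ### First bad index -/

/-- `t` is the first index after `i` with slope exceeding the slope of the diagonal. -/
def FB (r n i t : ℕ) : Prop :=
  i < t ∧ df r n t < df r n i ∧ ∀ u, i < u → u < t → df r n i ≤ df r n u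

theorem FB_unique {r n i t t' : ℕ} (h : FB r n i t) (h' : FB r n i t') : t = t' := by
  obtain ⟨a1, a2, a3⟩ := h
  obtain ⟨b1, b2, b3⟩ := h'
  rcases lt_trichotomy t t' with hh | hh | hh
  · have := b3 t a1 hh; omega
  · exact hh
  · have := a3 t' b1 hh; omega

theorem FB_pos {r n i t : ℕ} (hr : 2 ≤ r) (hn : 2 ≤ n) (h : FB r n i t) : 1 ≤ i := by
  rcases Nat.eq_zero_or_pos i with rfl | h0
  · have := h.2.1
    rw [df_zero hr hn] at this
    have := df_nonneg hr hn t
    omega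
  · exact h0

theorem FB_two {r i t : ℕ} (hr : 2 ≤ r) : ¬ FB r 2 i t := by
  intro h
  have h1 := h.2.1
  have h2 := df_lt hr (le_refl 2) i
  have h3 := df_nonneg hr (le_refl 2) t
  rw [c_two] at h2
  omega

/-- Non-vertex positions have large defect. -/
theorem df_large {r n : ℕ} (hr : 2 ≤ r) (hn : 2 ≤ n) {t j : ℕ} (h1 : v r n j < t)
    (h2 : t < v r n (j + 1)) : c r n ≤ df r (n + 1) t := by
  rw [df_next hr hn h1.le h2]
  have a := df_nonneg hr hn j
  have b := c_pos hr hn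
  have : (1 : ℤ) ≤ (t : ℤ) - v r n j := by omega
  nlinarith

theorem FB_nonvertex {r n : ℕ} (hr : 2 ≤ r) (hn : 2 ≤ n) {i j : ℕ} (h1 : v r n j < i)
    (h2 : i < v r n (j + 1)) : FB r (n + 1) i (v r n (j + 1)) := by
  refine ⟨h2, ?_, ?_⟩
  · rw [df_next_v hr hn]
    exact lt_of_lt_of_le (df_lt hr hn _) (df_large hr hn h1 h2)
  · intro u hu1 hu2
    rw [df_next hr hn h1.le h2, df_next hr hn (by omega) hu2]
    have b := c_pos hr hn
    have : (i : ℤ) < u := by exact_mod_cast hu1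
    nlinarith

theorem FB_vertex {r n : ℕ} (hr : 2 ≤ r) (hn : 2 ≤ n) {i t : ℕ} (h : FB r n i t) :
    FB r (n + 1) (v r n i) (v r n t) := by
  obtain ⟨h1, h2, h3⟩ := h
  refine ⟨v_strictMono hr hn h1, ?_, ?_⟩
  · rw [df_next_v hr hn, df_next_v hr hn]; exact h2
  · intro u hu1 hu2
    obtain ⟨j, a1, a2⟩ := exists_block hr hn u
    rw [df_next_v hr hn]
    rcases eq_or_lt_of_le a1 with e | e
    · subst e
      rw [df_next_v hr hn]
      exact h3 j ((v_strictMono hr hn).lt_iff_lt.1 hu1) ((v_strictMono hr hn).lt_iff_lt.1 hu2)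
    · have := df_large hr hn e a2
      have := df_lt hr hn i
      omega

theorem FB_vertex_inv {r n : ℕ} (hr : 2 ≤ r) (hn : 2 ≤ n) {i t' : ℕ}
    (h : FB r (n + 1) (v r n i) t') : ∃ t, t' = v r n t ∧ FB r n i t := by
  obtain ⟨h1, h2, h3⟩ := h
  rw [df_next_v hr hn] at h2
  obtain ⟨j, a1, a2⟩ := exists_block hr hn t'
  rcases eq_or_lt_of_le a1 with e | e
  · subst e
    refine ⟨j, rfl, (v_strictMono hr hn).lt_iff_lt.1 h1, ?_, ?_⟩
    · rwa [df_next_v hr hn] at h2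
    · intro u b1 b2
      have := h3 (v r n u) (v_strictMono hr hn b1) (v_strictMono hr hn b2)
      rwa [df_next_v hr hn, df_next_v hr hn] at this
  · have := df_large hr hn e a2
    have := df_lt hr hn i
    omega

/-! ### The data `(m,w)` attached to a first bad index -/

/-- The length `L` is `c_m - w c_{m-1}`; the case `(3,r-1)` (that is `L = 1`) is the red one. -/
def Dt (r n : ℕ) (L : ℤ) (m w : ℕ) : Prop :=
  3 ≤ m ∧ m ≤ n ∧ 1 ≤ w ∧ w + 1 ≤ r ∧ (w + 1 = r → m = 3) ∧
    L = c r m - (w : ℤ) * c r (m - 1)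

theorem Dt_bounds {r n : ℕ} (hr : 2 ≤ r) {L : ℤ} {m w : ℕ} (h : Dt r n L m w)
    (hw : w + 1 < r) : c r (m - 1) < L ∧ L ≤ c r m - c r (m - 1) ∧ 2 ≤ L := by
  obtain ⟨h1, h2, h3, h4, h5, h6⟩ := h
  obtain ⟨k, rfl⟩ : ∃ k, m = k + 2 := ⟨m - 2, by omega⟩
  rw [show k + 2 - 1 = k + 1 from rfl] at *
  have a := c_add_two r k
  have b := (c_aux r hr k).2
  have d := c_pos hr (n := k + 1) (by omega)
  have h3' : (1 : ℤ) ≤ w := by exact_mod_cast h3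
  have hw' : (w : ℤ) + 2 ≤ r := by exact_mod_cast hw
  refine ⟨?_, ?_, ?_⟩ <;> nlinarith

theorem Dt_red {r n : ℕ} {L : ℤ} {m w : ℕ} (h : Dt r n L m w) (hw : w + 1 = r) :
    m = 3 ∧ L = 1 := by
  obtain ⟨h1, h2, h3, h4, h5, h6⟩ := h
  have := h5 hw
  subst this
  refine ⟨rfl, ?_⟩
  rw [h6, c_three, show 3 - 1 = 2 from rfl, c_two, ← hw]
  push_cast; ring

theorem Dt_unique {r n n' : ℕ} (hr : 2 ≤ r) {L : ℤ} {m w m' w' : ℕ} (h : Dt r n L m w)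
    (h' : Dt r n' L m' w') : m = m' ∧ w = w' := by
  have hw := h.2.2.2.1
  have hw' := h'.2.2.2.1
  rcases Nat.lt_or_ge (w + 1) r with e | e
  · rcases Nat.lt_or_ge (w' + 1) r with e' | e'
    · have b := Dt_bounds hr h e
      have b' := Dt_bounds hr h' e'
      have hm : m = m' := by
        rcases lt_trichotomy m m' with q | q | q
        · have := c_mono hr (show m ≤ m' - 1 by omega)
          have := c_nonneg hr (n := m - 1) (by have := h.1; omega)
          omega
        · exact q
        · have := c_mono hr (show m' ≤ m - 1 by omega)
          have := c_nonneg hr (n := m' - 1) (by have := h'.1; omega)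
          omega
      subst hm
      refine ⟨rfl, ?_⟩
      have e1 := h.2.2.2.2.2
      have e2 := h'.2.2.2.2.2
      have hp := c_pos hr (n := m - 1) (by have := h.1; omega)
      have : ((w : ℤ) - w') * c r (m - 1) = 0 := by linarith
      rcases mul_eq_zero.1 this with q | q <;> omega
    · have b := Dt_bounds hr h e
      have b' := Dt_red h' (by omega)
      omega
  · have b := Dt_red h (by omega)
    rcases Nat.lt_or_ge (w' + 1) r with e' | e'
    · have b' := Dt_bounds hr h' e'
      omega
    · have b' := Dt_red h' (by omega)
      omega

/-- The number of preceding edges to be considered. -/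
def GR (r n : ℕ) (L : ℤ) (G : ℕ) : Prop :=
  ∃ m w, Dt r n L m w ∧ (G : ℤ) = c r (m - 1) - (w : ℤ) * c r (m - 2)

theorem GR_unique {r n n' : ℕ} (hr : 2 ≤ r) {L : ℤ} {G G' : ℕ} (h : GR r n L G)
    (h' : GR r n' L G') : G = G' := by
  obtain ⟨m, w, h1, h2⟩ := h
  obtain ⟨m', w', h1', h2'⟩ := h'
  obtain ⟨rfl, rfl⟩ := Dt_unique hr h1 h1'
  have : (G : ℤ) = G' := by rw [h2, h2']
  exact_mod_cast this

theorem Dt_G_pos {r n : ℕ} (hr : 2 ≤ r) {L : ℤ} {m w : ℕ} (h : Dt r n L m w) :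
    1 ≤ c r (m - 1) - (w : ℤ) * c r (m - 2) := by
  obtain ⟨h1, h2, h3, h4, h5, h6⟩ := h
  obtain ⟨k, rfl⟩ : ∃ k, m = k + 3 := ⟨m - 3, by omega⟩
  rw [show k + 3 - 1 = k + 2 from rfl, show k + 3 - 2 = k + 1 from rfl, c_add_two]
  rcases Nat.eq_zero_or_pos k with rfl | hk
  · simp [c]
  · have a := (c_aux r hr k).2
    have d := c_pos hr (n := k + 1) (by omega)
    have hw' : (w : ℤ) + 2 ≤ r := by
      have : w + 1 ≠ r := fun e => by have := h5 e; omega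
      have : w + 2 ≤ r := by omega
      exact_mod_cast this
    nlinarith

theorem GR_pos {r n : ℕ} (hr : 2 ≤ r) {L : ℤ} {G : ℕ} (h : GR r n L G) : 1 ≤ G := by
  obtain ⟨m, w, h1, h2⟩ := h
  have := Dt_G_pos hr h1
  rw [← h2] at this
  exact_mod_cast this

/-- Comparison of the preceding edges in two consecutive Dyck paths. -/
theorem geo {r n : ℕ} (hr : 2 ≤ r) (hn : 2 ≤ n) {i L G : ℕ} (h : GR r n L G)
    (hG : G ≤ v r n i) :
    v r (n + 1) (v r n i - G) + L ≤ v r (n + 1) (v r n i) ∧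
      v r (n + 1) (v r n i) < v r (n + 1) (v r n i - G + 1) + L := by
  obtain ⟨m, w, ⟨h1, h2, h3, h4, h5, h6⟩, hg⟩ := h
  have hdf0 := df_nonneg hr (n := n + 1) (by omega) (v r n i)
  have hdf1 : df r (n + 1) (v r n i) < c r n := by
    rw [df_next_v hr hn]; exact df_lt hr hn i
  have e1 : c r m * c r (n + 1) - c r (m - 1) * c r (n + 2) = c r (n - m + 3) := by
    have := c_cross r (m - 1) (n - m + 2)
    rw [show m - 1 + 1 = m by omega, show m - 1 + (n - m + 2) = n + 1 by omega] at this
    exact this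
  have e2 : c r (m - 1) * c r (n + 1) - c r (m - 2) * c r (n + 2) = c r (n - m + 4) := by
    have := c_cross r (m - 2) (n - m + 3)
    rw [show m - 2 + 1 = m - 1 by omega, show m - 2 + (n - m + 3) = n + 1 by omega] at this
    exact this
  have key : (L : ℤ) * c r (n + 1) - (G : ℤ) * c r (n + 2)
      = c r (n - m + 3) - w * c r (n - m + 4) := by
    rw [h6, hg, ← e1, ← e2]; ring
  have f1 := (c_aux r hr (n - m + 3)).2
  have f2 := c_pos hr (n := n - m + 3) (by omega)
  have f3 := c_mono hr (show n - m + 4 ≤ n + 1 by omega)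
  have h3' : (1 : ℤ) ≤ w := by exact_mod_cast h3
  have f4 := c_add_two r n
  have f5 := (c_aux r hr n).2
  have f6 := c_pos hr hn
  have q1 : c r (n - m + 3) - w * c r (n - m + 4) ≤ 0 := by
    rw [show n - m + 3 + 1 = n - m + 4 from rfl] at f1
    nlinarith
  have q2 : df r (n + 1) (v r n i) < c r (n + 2) + (c r (n - m + 3) - w * c r (n - m + 4)) := by
    by_cases hw : w + 1 = r
    · have := h5 hw
      subst this
      have hw' : (r : ℤ) = w + 1 := by rw [← hw]; push_cast; ring
      rw [show n - 3 + 3 = n by omega, show n - 3 + 4 = n + 1 by omega, f4, hw']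
      nlinarith
    · have hw' : (w : ℤ) + 2 ≤ r := by
        have : w + 2 ≤ r := by omega
        exact_mod_cast this
      have : (w : ℤ) * c r (n - m + 4) ≤ (r - 2) * c r (n + 1) := by
        rw [show n - m + 3 + 1 = n - m + 4 from rfl] at f1
        apply mul_le_mul <;> linarith
      nlinarith
  unfold df at hdf0 hdf1 q2
  rw [show n + 1 + 1 = n + 2 from rfl] at *
  have A : v r (n + 1) (v r n i - G) + L ≤ v r (n + 1) (v r n i) ↔ True := by
    rw [iff_true]
    have hL : L ≤ v r (n + 1) (v r n i) := by
      have p1 : (0 : ℤ) ≤ ((v r n i : ℤ) - G) * c r (n + 2) := by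
        apply mul_nonneg
        · have : (G : ℤ) ≤ v r n i := by exact_mod_cast hG
          linarith
        · exact c_nonneg hr (by omega)
      have p2 : (L : ℤ) * c r (n + 1) ≤ (v r (n + 1) (v r n i) : ℤ) * c r (n + 1) := by
        nlinarith
      have := le_of_mul_le_mul_right p2 (by linarith)
      exact_mod_cast this
    have : v r (n + 1) (v r n i - G) ≤ v r (n + 1) (v r n i) - L := by
      rw [v_le_iff hr (by omega), Nat.cast_sub hL, Nat.cast_sub hG]
      rw [show n + 1 + 1 = n + 2 from rfl]
      nlinarith
    omega
  refine ⟨A.2 trivial, ?_⟩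
  have A' := A.2 trivial
  by_contra hcon
  push Not at hcon
  have : v r (n + 1) (v r n i - G + 1) ≤ v r (n + 1) (v r n i) - L := by omega
  rw [v_le_iff hr (by omega), Nat.cast_sub (by omega)] at this
  push_cast [Nat.cast_sub hG] at this
  rw [show n + 1 + 1 = n + 2 from rfl] at *
  nlinarith

/-- Main structural result on first bad indices. -/
theorem FB_data {r : ℕ} (hr : 2 ≤ r) {n : ℕ} (hn : 2 ≤ n) : ∀ i t, FB r n i t →
    ∃ m w, Dt r n ((t : ℤ) - i) m w ∧
      (v r n t : ℤ) - v r n i = c r (m + 1) - w * c r m ∧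
      c r (m - 1) - (w : ℤ) * c r (m - 2) ≤ v r n i := by
  induction n, hn using Nat.le_induction with
  | base => intro i t h; exact absurd h (FB_two hr)
  | succ n hn ih =>
    intro i' t' h
    obtain ⟨j, a1, a2⟩ := exists_block hr hn i'
    rcases eq_or_lt_of_le a1 with e | e
    · subst e
      obtain ⟨t, rfl, hfb⟩ := FB_vertex_inv hr hn h
      obtain ⟨m, w, hD, hv, hGle⟩ := ih j t hfb
      have hjt := hfb.1
      have hGpos := Dt_G_pos hr hD
      have hGR : GR r n ((t - j : ℕ) : ℤ) (c r (m - 1) - (w : ℤ) * c r (m - 2)).toNat :=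
        ⟨m, w, by rw [Nat.cast_sub hjt.le]; exact hD, Int.toNat_of_nonneg (by omega)⟩
      have hg := (geo hr hn (i := j) hGR (by omega)).1
      have hLle : (t : ℤ) - j ≤ v r (n + 1) (v r n j) := by omega
      have hv' : (v r (n + 1) (v r n t) : ℤ) - v r (n + 1) (v r n j)
          = r * (c r (m + 1) - w * c r m) - ((t : ℤ) - j) := by
        rw [v_next_v hr hn, v_next_v hr hn, ← hv]; ring
      have hD' := hD
      obtain ⟨h1, h2, h3, h4, h5, h6⟩ := hD
      by_cases hw : w + 1 = r
      · obtain ⟨rfl, hL1⟩ := Dt_red hD' hw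
        have hw' : (w : ℤ) = r - 1 := by rw [← hw]; push_cast; ring
        refine ⟨3, 1, ⟨le_rfl, by omega, le_rfl, by omega, fun _ => rfl, ?_⟩, ?_, ?_⟩
        · rw [hv, hw', show 3 + 1 = 4 from rfl, c_four, c_three, show 3 - 1 = 2 from rfl, c_two]
          push_cast; ring
        · rw [hv', hL1, hw', show 3 + 1 = 4 from rfl, c_four, c_three]
          push_cast; ring
        · rw [show 3 - 1 = 2 from rfl, show 3 - 2 = 1 from rfl, c_two, c_one]
          push_cast
          omega
      · refine ⟨m + 1, w, ⟨by omega, by omega, h3, h4, fun q => absurd q hw, ?_⟩, ?_, ?_⟩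
        · rw [hv]; rfl
        · rw [hv', h6, show m + 1 + 1 = m + 2 from rfl]
          have g1 := c_add_two r m
          have g2 := c_add_two r (m - 1)
          rw [show m - 1 + 2 = m + 1 by omega, show m - 1 + 1 = m by omega] at g2
          rw [g1, g2]; ring
        · rw [show m + 1 - 1 = m from rfl, show m + 1 - 2 = m - 1 from by omega, ← h6]
          exact hLle
    · have hfb := FB_nonvertex hr hn e a2
      have ht := FB_unique h hfb
      subst ht
      have hle := v_sub_le hr hn j
      have hn3 : 3 ≤ n + 1 := by omega
      have hwc : ((r + i' - v r n (j + 1) : ℕ) : ℤ) = r + i' - v r n (j + 1) := by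
        rw [Nat.cast_sub (by omega)]; push_cast; ring
      refine ⟨3, r + i' - v r n (j + 1),
        ⟨le_rfl, hn3, by omega, by omega, fun _ => rfl, ?_⟩, ?_, ?_⟩
      · rw [hwc, c_three, show 3 - 1 = 2 from rfl, c_two]; ring
      · rw [v_next_v hr hn, v_next hr hn a1 a2, hwc, show 3 + 1 = 4 from rfl, c_four, c_three]
        push_cast; ring
      · rw [show 3 - 1 = 2 from rfl, show 3 - 2 = 1 from rfl, c_two, c_one]
        have := (v_strictMono hr (n := n + 1) (by omega)).le_apply (x := i')
        push_cast
        omega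

theorem FB_GR {r n : ℕ} (hr : 2 ≤ r) (hn : 2 ≤ n) {i t : ℕ} (h : FB r n i t) :
    ∃ G, GR r n ((t : ℤ) - i) G ∧ 1 ≤ G ∧ G ≤ v r n i := by
  obtain ⟨m, w, hD, hv, hG⟩ := FB_data hr hn i t h
  have hp := Dt_G_pos hr hD
  refine ⟨(c r (m - 1) - (w : ℤ) * c r (m - 2)).toNat,
    ⟨m, w, hD, Int.toNat_of_nonneg (by omega)⟩, by omega, by omega⟩

theorem GR_one {r n : ℕ} (hn : 3 ≤ n) {L : ℤ} (h1 : 1 ≤ L) (h2 : L + 1 ≤ r) :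
    GR r n L 1 := by
  have hw : (((r : ℤ) - L).toNat : ℤ) = r - L := Int.toNat_of_nonneg (by omega)
  refine ⟨3, ((r : ℤ) - L).toNat, ⟨le_rfl, hn, by omega, by omega, fun _ => rfl, ?_⟩, ?_⟩
  · rw [hw, c_three, show 3 - 1 = 2 from rfl, c_two]; ring
  · rw [hw, show 3 - 1 = 2 from rfl, show 3 - 2 = 1 from rfl, c_two, c_one]; simp

theorem GR_nonvertex {r n : ℕ} (hr : 2 ≤ r) (hn : 2 ≤ n) {i j : ℕ} (h1 : v r n j < i)
    (h2 : i < v r n (j + 1)) : GR r (n + 1) ((v r n (j + 1) : ℤ) - i) 1 := by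
  have := v_sub_le hr hn j
  exact GR_one (by omega) (by omega) (by omega)

theorem GR_vertex {r n : ℕ} (hr : 2 ≤ r) (hn : 2 ≤ n) {i t : ℕ} (h : FB r n i t) :
    GR r (n + 1) ((v r n t : ℤ) - v r n i) (t - i) := by
  obtain ⟨m, w, hD, hv, hG⟩ := FB_data hr hn i t h
  have hD' := hD
  obtain ⟨h1, h2, h3, h4, h5, h6⟩ := hD
  have hit := h.1
  by_cases hw : w + 1 = r
  · obtain ⟨rfl, hL1⟩ := Dt_red hD' hw
    have hw' : (w : ℤ) = r - 1 := by rw [← hw]; push_cast; ring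
    have : (v r n t : ℤ) - v r n i = r - 1 := by
      rw [hv, hw', show 3 + 1 = 4 from rfl, c_four, c_three]; ring
    rw [this, show t - i = 1 by omega]
    exact GR_one (by omega) (by omega) (by omega)
  · refine ⟨m + 1, w, ⟨by omega, by omega, h3, h4, fun q => absurd q hw, ?_⟩, ?_⟩
    · rw [hv]; rfl
    · rw [show m + 1 - 1 = m from rfl, show m + 1 - 2 = m - 1 from by omega, ← h6,
        Nat.cast_sub hit.le]

/-! ### Translation of the definitions -/

theorem slopeLE_iff {r n : ℕ} (i t : ℕ) :
    slopeLE r (n + 2) i t ↔ df r n i ≤ df r n t := by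
  unfold slopeLE df vx
  rw [show n + 2 - 1 = n + 1 from rfl, show n + 2 - 2 = n from rfl]
  rw [show vpos r (n + 2) t = v r n t from rfl, show vpos r (n + 2) i = v r n i from rfl]
  constructor <;> intro h <;> linarith

theorem mem_badSet {r n i k t : ℕ} :
    t ∈ badSet r (n + 2) i k ↔ i < t ∧ t ≤ k ∧ df r n t < df r n i := by
  unfold badSet
  rw [Finset.mem_filter, Finset.mem_Icc, slopeLE_iff, not_le, Nat.succ_le_iff, and_assoc]

theorem minBad_iff {r n i k t : ℕ} : minBad r (n + 2) i k t ↔ FB r n i t ∧ t ≤ k := by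
  unfold minBad FB
  simp only [mem_badSet]
  constructor
  · rintro ⟨⟨a, b, d⟩, h⟩
    refine ⟨⟨a, d, fun u h1 h2 => ?_⟩, b⟩
    by_contra hu
    have := h u ⟨h1, by omega, by omega⟩
    omega
  · rintro ⟨⟨a, d, h⟩, b⟩
    refine ⟨⟨a, b, d⟩, fun u hu => ?_⟩
    by_contra hlt
    have := h u hu.1 (by omega)
    omega

theorem isBlue_iff {r n i k : ℕ} : isBlue r (n + 2) i k ↔ ¬ ∃ t, FB r n i t ∧ t ≤ k := by
  unfold isBlue
  constructor
  · rintro h ⟨t, ht⟩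
    have := (minBad_iff.2 ht).1
    rw [h] at this
    simp at this
  · intro h
    by_contra hne
    have hne' := Finset.nonempty_iff_ne_empty.2 hne
    apply h
    refine ⟨_, minBad_iff.1 ⟨Finset.min'_mem _ hne', fun t ht => Finset.min'_le _ t ht⟩⟩

theorem isGreenMW_iff {r n i k m w : ℕ} : isGreenMW r (n + 2) i k m w ↔
    w + 1 < r ∧ ∃ t, FB r n i t ∧ t ≤ k ∧ Dt r n ((t : ℤ) - i) m w := by
  unfold isGreenMW Dt
  simp only [minBad_iff]
  constructor
  · rintro ⟨h1, h2, h3, h4, t, ⟨h5, h6⟩, h7⟩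
    exact ⟨by omega, t, h5, h6, h1, by omega, h3, by omega, by omega, by omega⟩
  · rintro ⟨h0, t, h5, h6, h1, h2, h3, h4, h8, h7⟩
    exact ⟨h1, by omega, h3, by omega, t, ⟨h5, h6⟩, by omega⟩

theorem isRed_iff {r n i k : ℕ} (hr : 2 ≤ r) (hn : 2 ≤ n) (hik : i < k) :
    isRed r (n + 2) i k ↔ FB r n i (i + 1) := by
  unfold isRed isGreen
  rw [isBlue_iff, not_not]
  constructor
  · rintro ⟨⟨t, ht, htk⟩, hng⟩
    obtain ⟨m, w, hD, -, -⟩ := FB_data hr hn i t ht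
    have hw := hD.2.2.2.1
    by_cases hw' : w + 1 = r
    · have := (Dt_red hD hw').2
      rwa [show t = i + 1 by omega] at ht
    · exact absurd ⟨m, w, isGreenMW_iff.2 ⟨by omega, t, ht, htk, hD⟩⟩ hng
  · intro h
    refine ⟨⟨_, h, hik⟩, ?_⟩
    rintro ⟨m, w, hg⟩
    obtain ⟨hw, t, ht, htk, hD⟩ := isGreenMW_iff.1 hg
    have := FB_unique h ht
    have := (Dt_bounds hr hD hw).2.2
    omega

theorem mem_edges_inr {r n i k e : ℕ} (hr : 2 ≤ r) (hn : 2 ≤ n) (hik : i < k) :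
    e ∈ edges r (n + 2) (Sum.inr (i, k)) ↔
      (v r n i < e ∧ e ≤ v r n k) ∨ (FB r n i (i + 1) ∧ e = v r n i) := by
  have hv := v_strictMono hr hn hik
  change e ∈ (if isRed r (n + 2) i k then Finset.Icc (v r n i) (v r n k)
      else Finset.Icc (v r n i + 1) (v r n k)) ↔ _
  by_cases h : FB r n i (i + 1)
  · simp only [if_pos ((isRed_iff hr hn hik).2 h), Finset.mem_Icc, h, true_and]
    omega
  · simp only [if_neg ((isRed_iff hr hn hik).not.2 h), Finset.mem_Icc, h, false_and, or_false]
    omega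

theorem mem_edges_inl {r n j e : ℕ} : e ∈ edges r n (Sum.inl j) ↔ e = j := by
  simp [edges]

theorem mem_precEdges {r n i m w e : ℕ} : e ∈ precEdges r (n + 2) i m w ↔
    v r n i < e + (c r (m - 1) - (w : ℤ) * c r (m - 2)).toNat ∧ e ≤ v r n i := by
  unfold precEdges
  rw [show vpos r (n + 2) i = v r n i from rfl, Finset.mem_Icc]
  omega

/-! ### Pairs of sets -/

/-- The indices of vertical edges covered by the subpaths of `β`. -/
def US (β : Finset Elt) : Finset ℕ :=
  β.biUnion fun p => match p with
    | Sum.inl _ => ∅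
    | Sum.inr (i, k) => Finset.Ioc i k

/-- The edges covered by `β`. -/
noncomputable def TS (r n : ℕ) (β : Finset Elt) : Finset ℕ := β.biUnion (edges r (n + 2))

theorem mem_US {β : Finset Elt} {j : ℕ} :
    j ∈ US β ↔ ∃ i k, Sum.inr (i, k) ∈ β ∧ i < j ∧ j ≤ k := by
  unfold US
  rw [Finset.mem_biUnion]
  constructor
  · rintro ⟨p, hp, hj⟩
    rcases p with a | ⟨i, k⟩
    · simp at hj
    · exact ⟨i, k, hp, Finset.mem_Ioc.1 hj⟩
  · rintro ⟨i, k, hp, hj⟩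
    exact ⟨_, hp, Finset.mem_Ioc.2 hj⟩

theorem mem_TS {r n : ℕ} {β : Finset Elt} {e : ℕ} :
    e ∈ TS r n β ↔ ∃ p ∈ β, e ∈ edges r (n + 2) p := by
  unfold TS; rw [Finset.mem_biUnion]

/-- `(i,k]` is a maximal interval of `U`. -/
def Comp (U : Finset ℕ) (i k : ℕ) : Prop :=
  i < k ∧ i ∉ U ∧ k + 1 ∉ U ∧ ∀ j, i < j → j ≤ k → j ∈ U

theorem Comp_unique {U : Finset ℕ} {i k i' k' j : ℕ} (h : Comp U i k) (h' : Comp U i' k')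
    (h1 : i < j) (h2 : j ≤ k) (h3 : i' < j) (h4 : j ≤ k') : i = i' ∧ k = k' := by
  obtain ⟨a1, a2, a3, a4⟩ := h
  obtain ⟨b1, b2, b3, b4⟩ := h'
  constructor
  · rcases lt_trichotomy i i' with q | q | q
    · exact absurd (a4 i' q (by omega)) b2
    · exact q
    · exact absurd (b4 i q (by omega)) a2
  · rcases lt_trichotomy k k' with q | q | q
    · exact absurd (b4 (k + 1) (by omega) (by omega)) a3
    · exact q
    · exact absurd (a4 (k' + 1) (by omega) (by omega)) b3

theorem exists_Comp {U : Finset ℕ} (h0 : 0 ∉ U) {j : ℕ} (hj : j ∈ U) :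
    ∃ i k, Comp U i k ∧ i < j ∧ j ≤ k := by
  have hj0 : j ≠ 0 := fun e => h0 (e ▸ hj)
  have hex : ∃ k, j ≤ k ∧ k + 1 ∉ U := by
    by_contra hcon
    push Not at hcon
    have : ∀ k, j ≤ k → k ∈ U := by
      intro k hk
      induction k, hk using Nat.le_induction with
      | base => exact hj
      | succ k hk ih => exact hcon k hk
    have h2 := this (U.sup id + j + 1) (by omega)
    have h3 : U.sup id + j + 1 ≤ U.sup id := Finset.le_sup (f := id) h2
    omega
  have hex2 : ∃ a, a < j ∧ j - 1 - a ∉ U := ⟨j - 1, by omega, by simpa using h0⟩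
  have s1 := Nat.find_spec hex
  have s2 := Nat.find_spec hex2
  refine ⟨j - 1 - Nat.find hex2, Nat.find hex, ⟨by omega, s2.2, s1.2, ?_⟩, by omega, s1.1⟩
  intro u hu1 hu2
  rcases lt_trichotomy u j with q | q | q
  · have := Nat.find_min hex2 (m := j - 1 - u) (by omega)
    push Not at this
    have := this (by omega)
    rwa [show j - 1 - (j - 1 - u) = u by omega] at this
  · exact q ▸ hj
  · have := Nat.find_min hex (m := u - 1) (by omega)
    push Not at this
    have := this (by omega)
    rwa [show u - 1 + 1 = u by omega] at this

theorem valid_lt {r n : ℕ} {β : Finset Elt} (h : validColl r n β) {i k : ℕ}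
    (hik : Sum.inr (i, k) ∈ β) : i < k := (h.1 _ hik).1

theorem valid_overlap {r n : ℕ} (hr : 2 ≤ r) (hn : 2 ≤ n) {β : Finset Elt}
    (h : validColl r (n + 2) β) {i k i' k' j : ℕ} (h1 : Sum.inr (i, k) ∈ β)
    (h2 : Sum.inr (i', k') ∈ β) (a : i < j) (b : j ≤ k) (a' : i' < j) (b' : j ≤ k') :
    i = i' ∧ k = k' := by
  by_contra hne
  have hd := h.2.1 _ h1 _ h2 (fun e => hne (by simpa using e))
  have m := v_strictMono hr hn
  refine (Finset.disjoint_left.1 hd : ∀ ⦃a : ℕ⦄, _) (?_ : v r n j ∈ _) ?_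
  · rw [mem_edges_inr hr hn (by omega)]
    exact Or.inl ⟨m a, m.monotone b⟩
  · rw [mem_edges_inr hr hn (by omega)]
    exact Or.inl ⟨m a', m.monotone b'⟩

theorem valid_Comp {r n : ℕ} (hr : 2 ≤ r) (hn : 2 ≤ n) {β : Finset Elt}
    (h : validColl r (n + 2) β) {i k : ℕ} : Sum.inr (i, k) ∈ β ↔ Comp (US β) i k := by
  have fwd : ∀ i k, Sum.inr (i, k) ∈ β → Comp (US β) i k := by
    intro i k hik
    have hlt := valid_lt h hik
    refine ⟨hlt, ?_, ?_, fun j a b => mem_US.2 ⟨i, k, hik, a, b⟩⟩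
    · intro hi
      obtain ⟨i', k', hik', a, b⟩ := mem_US.1 hi
      have := (h.2.2 _ _ _ _ hik hik').1
      have := valid_overlap hr hn h hik hik' (j := i + 1) (by omega) (by omega) (by omega)
        (by omega)
      omega
    · intro hi
      obtain ⟨i', k', hik', a, b⟩ := mem_US.1 hi
      have := (h.2.2 _ _ _ _ hik hik').2
      have := valid_overlap hr hn h hik hik' (j := k) (by omega) (by omega) (by omega)
        (by omega)
      omega
  refine ⟨fwd i k, fun hc => ?_⟩
  obtain ⟨i', k', hik', a, b⟩ := mem_US.1 (hc.2.2.2 k hc.1 le_rfl)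
  obtain ⟨rfl, rfl⟩ := Comp_unique hc (fwd _ _ hik') hc.1 le_rfl a b
  exact hik'

theorem B1_eq {r n : ℕ} (hr : 2 ≤ r) (hn : 2 ≤ n) {β : Finset Elt}
    (h : validColl r (n + 2) β) : B1 β = (US β).card := by
  unfold US
  rw [Finset.card_biUnion]
  · unfold B1
    refine Finset.sum_congr rfl fun p hp => ?_
    rcases p with a | ⟨i, k⟩ <;> simp [wt1]
  · intro p hp q hq hpq
    rcases p with a | ⟨i, k⟩
    · simp
    rcases q with b | ⟨i', k'⟩
    · simp
    change Disjoint (Finset.Ioc i k) (Finset.Ioc i' k')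
    rw [Finset.disjoint_left]
    intro j hj hj'
    rw [Finset.mem_Ioc] at hj hj'
    have := valid_overlap hr hn h hp hq hj.1 hj.2 hj'.1 hj'.2
    apply hpq
    rw [this.1, this.2]

/-- The relation between sets `U` of vertical edges and sets `T` of edges of `D_{n+2}`. -/
def RR (r n : ℕ) (U T : Finset ℕ) : Prop :=
  U ⊆ Finset.Icc 1 (cN r n) ∧ T ⊆ Finset.Icc 1 (cN r (n + 1)) ∧
  (∀ j e, j + 1 ∈ U → v r n j < e → e ≤ v r n (j + 1) → e ∈ T) ∧
  ∀ i t G, i ∉ U → FB r n i t → GR r n ((t : ℤ) - i) G → (∀ j, i < j → j ≤ t → j ∈ U) →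
    ∃ e ∈ T, v r n i < e + G ∧ e ≤ v r n i

theorem RR_of_FD {r n : ℕ} (hr : 2 ≤ r) (hn : 2 ≤ n) {β : Finset Elt}
    (hβ : β ∈ FD r (n + 2)) : RR r n (US β) (TS r n β) := by
  obtain ⟨h, hgreen⟩ := hβ
  have hc1 := cN_cast hr (n := n) (by omega)
  have hc2 := cN_cast hr (n := n + 1) (by omega)
  have m := v_strictMono hr hn
  have hk : ∀ i k, Sum.inr (i, k) ∈ β → k ≤ cN r n := by
    intro i k hik
    have h2 : (k : ℤ) ≤ c r n := (h.1 _ hik).2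
    rw [← hc1] at h2
    exact_mod_cast h2
  refine ⟨?_, ?_, ?_, ?_⟩
  · intro j hj
    obtain ⟨i, k, hik, a, b⟩ := mem_US.1 hj
    have := hk i k hik
    rw [Finset.mem_Icc]; omega
  · intro e he
    obtain ⟨p, hp, hep⟩ := mem_TS.1 he
    rw [Finset.mem_Icc]
    rcases p with j | ⟨i, k⟩
    · rw [mem_edges_inl] at hep
      subst hep
      obtain ⟨a, b⟩ := h.1 _ hp
      have b' : (e : ℤ) ≤ c r (n + 1) := b
      rw [← hc2] at b'
      exact ⟨a, by exact_mod_cast b'⟩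
    · have hlt := valid_lt h hp
      rw [mem_edges_inr hr hn hlt] at hep
      have h1 := m.monotone (hk i k hp)
      rw [v_top hr hn] at h1
      have h2 := m hlt
      rcases hep with q | ⟨q1, q2⟩
      · omega
      · have := FB_pos hr hn q1
        have := m.le_apply (x := i)
        omega
  · intro j e hj he1 he2
    obtain ⟨i, k, hik, a, b⟩ := mem_US.1 hj
    refine mem_TS.2 ⟨_, hik, (mem_edges_inr hr hn (by omega)).2 (Or.inl ⟨?_, ?_⟩)⟩
    · have := m.monotone (show i ≤ j by omega)
      omega
    · have := m.monotone b
      omega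
  · intro i t G hi hfb hG hsub
    have hit := hfb.1
    obtain ⟨i', k, hik, a, b⟩ := mem_US.1 (hsub (i + 1) (by omega) hit)
    have hcomp := (valid_Comp hr hn h).1 hik
    have e1 : i' = i := by
      by_contra hne
      exact hi (hcomp.2.2.2 i (by omega) (by omega))
    subst e1
    have htk : t ≤ k := by
      by_contra hne
      exact hcomp.2.2.1 (hsub (k + 1) (by omega) (by omega))
    obtain ⟨mm, w, hD, hGeq⟩ := hG
    by_cases hw : w + 1 = r
    · obtain ⟨rfl, hL⟩ := Dt_red hD hw
      have ht : t = i' + 1 := by omega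
      subst ht
      have hG1 : (G : ℤ) = 1 := by
        rw [hGeq, show 3 - 1 = 2 from rfl, show 3 - 2 = 1 from rfl, c_two, c_one]; simp
      exact ⟨v r n i', mem_TS.2 ⟨_, hik, (mem_edges_inr hr hn (by omega)).2
        (Or.inr ⟨hfb, rfl⟩)⟩, by omega, le_rfl⟩
    · have hw2 := hD.2.2.2.1
      obtain ⟨e, he, p, hp, hep⟩ := hgreen i' k mm w hik
        (isGreenMW_iff.2 ⟨by omega, t, hfb, htk, hD⟩)
      rw [mem_precEdges, ← hGeq] at he
      exact ⟨e, mem_TS.2 ⟨p, hp, hep⟩, by omega, he.2⟩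

/-- The collection associated with a pair of sets. -/
noncomputable def Binv (r n : ℕ) (U T : Finset ℕ) : Finset Elt :=
  (((Finset.range (cN r n + 1)) ×ˢ (Finset.range (cN r n + 1))).filter
      fun q => Comp U q.1 q.2).image Sum.inr ∪
    (T.filter fun j => ∀ i k, Comp U i k → j ∉ edges r (n + 2) (Sum.inr (i, k))).image Sum.inl

theorem Binv_inr {r n : ℕ} {U T : Finset ℕ} (hU : U ⊆ Finset.Icc 1 (cN r n)) {i k : ℕ} :
    Sum.inr (i, k) ∈ Binv r n U T ↔ Comp U i k := by
  unfold Binv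
  simp only [Finset.mem_union, Finset.mem_image, Finset.mem_filter, Finset.mem_product,
    Finset.mem_range]
  constructor
  · rintro (⟨⟨a, b⟩, ⟨-, h⟩, e⟩ | ⟨j, -, e⟩)
    · simp only [Sum.inr.injEq, Prod.mk.injEq] at e
      rw [← e.1, ← e.2]; exact h
    · simp at e
  · intro h
    left
    have hk := Finset.mem_Icc.1 (hU (h.2.2.2 k h.1 le_rfl))
    have := h.1
    exact ⟨(i, k), ⟨⟨by simp only; omega, by simp only; omega⟩, h⟩, rfl⟩

theorem Binv_inl {r n : ℕ} {U T : Finset ℕ} {j : ℕ} :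
    Sum.inl j ∈ Binv r n U T ↔
      j ∈ T ∧ ∀ i k, Comp U i k → j ∉ edges r (n + 2) (Sum.inr (i, k)) := by
  unfold Binv
  simp

theorem Comp_edges_sub {r n : ℕ} (hr : 2 ≤ r) (hn : 2 ≤ n) {U T : Finset ℕ}
    (h : RR r n U T) {i k e : ℕ} (hc : Comp U i k)
    (he : e ∈ edges r (n + 2) (Sum.inr (i, k))) : e ∈ T := by
  obtain ⟨h1, h2, h3, h4⟩ := h
  have m := v_strictMono hr hn
  rw [mem_edges_inr hr hn hc.1] at he
  rcases he with ⟨a, b⟩ | ⟨a, b⟩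
  · obtain ⟨j, q1, q2⟩ := exists_block hr hn (e - 1)
    have ij : i < j + 1 := m.lt_iff_lt.1 (by omega)
    have jk : j < k := m.lt_iff_lt.1 (by omega)
    exact h3 j e (hc.2.2.2 (j + 1) (by omega) (by omega)) (by omega) (by omega)
  · obtain ⟨G, hG, hG1, hG2⟩ := FB_GR hr hn a
    have hn3 : 3 ≤ n := by
      by_contra hlt
      have : n = 2 := by omega
      subst this
      exact FB_two hr a
    have hG' := GR_one (r := r) hn3 (L := ((i + 1 : ℕ) : ℤ) - i) (by omega) (by omega)
    have hGe := GR_unique hr hG hG'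
    subst hGe
    have hik := hc.1
    obtain ⟨e', he', f1, f2⟩ := h4 i (i + 1) 1 hc.2.1 a hG
      (fun j q1 q2 => hc.2.2.2 j q1 (by omega))
    rwa [show e = e' by omega]

theorem US_Binv {r n : ℕ} {U T : Finset ℕ} (hU : U ⊆ Finset.Icc 1 (cN r n)) :
    US (Binv r n U T) = U := by
  ext j
  rw [mem_US]
  constructor
  · rintro ⟨i, k, h, a, b⟩
    exact ((Binv_inr hU).1 h).2.2.2 j a b
  · intro hj
    have h0 : 0 ∉ U := fun h => by have := Finset.mem_Icc.1 (hU h); omega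
    obtain ⟨i, k, hc, a, b⟩ := exists_Comp h0 hj
    exact ⟨i, k, (Binv_inr hU).2 hc, a, b⟩

theorem TS_Binv {r n : ℕ} (hr : 2 ≤ r) (hn : 2 ≤ n) {U T : Finset ℕ} (h : RR r n U T) :
    TS r n (Binv r n U T) = T := by
  have hU := h.1
  ext e
  rw [mem_TS]
  constructor
  · rintro ⟨p, hp, he⟩
    rcases p with j | ⟨i, k⟩
    · rw [mem_edges_inl] at he
      subst he
      exact (Binv_inl.1 hp).1
    · exact Comp_edges_sub hr hn h ((Binv_inr hU).1 hp) he
  · intro he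
    by_cases hc : ∀ i k, Comp U i k → e ∉ edges r (n + 2) (Sum.inr (i, k))
    · exact ⟨_, Binv_inl.2 ⟨he, hc⟩, mem_edges_inl.2 rfl⟩
    · push Not at hc
      obtain ⟨i, k, hc, hh⟩ := hc
      exact ⟨_, (Binv_inr hU).2 hc, hh⟩

theorem Comp_disjoint {r n : ℕ} (hr : 2 ≤ r) (hn : 2 ≤ n) {U : Finset ℕ} {i k i' k' : ℕ}
    (h : Comp U i k) (h' : Comp U i' k') (hlt : i < i') :
    Disjoint (edges r (n + 2) (Sum.inr (i, k))) (edges r (n + 2) (Sum.inr (i', k'))) := by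
  have m := v_strictMono hr hn
  have hk : k < i' := by
    by_contra hcon
    exact h'.2.1 (h.2.2.2 i' hlt (by omega))
  rw [Finset.disjoint_left]
  intro e he he'
  rw [mem_edges_inr hr hn h.1] at he
  rw [mem_edges_inr hr hn h'.1] at he'
  have := m hk
  have := m h.1
  omega

theorem Binv_FD {r n : ℕ} (hr : 2 ≤ r) (hn : 2 ≤ n) {U T : Finset ℕ} (h : RR r n U T) :
    Binv r n U T ∈ FD r (n + 2) := by
  have hU := h.1
  have hc1 := cN_cast hr (n := n) (by omega)
  have hc2 := cN_cast hr (n := n + 1) (by omega)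
  refine ⟨⟨?_, ?_, ?_⟩, ?_⟩
  · intro p hp
    rcases p with j | ⟨i, k⟩
    · have := Finset.mem_Icc.1 (h.2.1 (Binv_inl.1 hp).1)
      refine ⟨this.1, ?_⟩
      rw [show n + 2 - 1 = n + 1 from rfl, ← hc2]
      exact_mod_cast this.2
    · have hc := (Binv_inr hU).1 hp
      have := Finset.mem_Icc.1 (hU (hc.2.2.2 k hc.1 le_rfl))
      refine ⟨hc.1, ?_⟩
      rw [show n + 2 - 2 = n from rfl, ← hc1]
      exact_mod_cast this.2
  · intro p hp q hq hpq
    rcases p with j | ⟨i, k⟩ <;> rcases q with j' | ⟨i', k'⟩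
    · rw [Finset.disjoint_left]
      intro e he he'
      rw [mem_edges_inl] at he he'
      exact hpq (by rw [← he, ← he'])
    · rw [Finset.disjoint_left]
      intro e he he'
      rw [mem_edges_inl] at he
      subst he
      exact (Binv_inl.1 hp).2 _ _ ((Binv_inr hU).1 hq) he'
    · rw [Finset.disjoint_left]
      intro e he he'
      rw [mem_edges_inl] at he'
      subst he'
      exact (Binv_inl.1 hq).2 _ _ ((Binv_inr hU).1 hp) he
    · have a := (Binv_inr hU).1 hp
      have b := (Binv_inr hU).1 hq
      rcases lt_trichotomy i i' with w | w | w
      · exact Comp_disjoint hr hn a b w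
      · subst w
        have := (Comp_unique a b (j := i + 1) (by omega) a.1 (by omega) b.1).2
        exact absurd (by rw [this]) hpq
      · exact (Comp_disjoint hr hn b a w).symm
  · intro i k i' k' hp hq
    have a := (Binv_inr hU).1 hp
    have b := (Binv_inr hU).1 hq
    constructor
    · rintro rfl
      exact a.2.1 (b.2.2.2 i b.1 le_rfl)
    · rintro rfl
      exact b.2.1 (a.2.2.2 i' a.1 le_rfl)
  · intro i k m w hp hg
    have a := (Binv_inr hU).1 hp
    obtain ⟨hw, t, hfb, htk, hD⟩ := isGreenMW_iff.1 hg
    have hGp := Dt_G_pos hr hD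
    obtain ⟨e, he, f1, f2⟩ := h.2.2.2 i t (c r (m - 1) - (w : ℤ) * c r (m - 2)).toNat a.2.1 hfb
      ⟨m, w, hD, Int.toNat_of_nonneg (by omega)⟩ (fun j q1 q2 => a.2.2.2 j q1 (by omega))
    refine ⟨e, mem_precEdges.2 ⟨f1, f2⟩, ?_⟩
    rw [← TS_Binv hr hn h] at he
    exact mem_TS.1 he

theorem FD_inj {r n : ℕ} (hr : 2 ≤ r) (hn : 2 ≤ n) {β β' : Finset Elt}
    (h : validColl r (n + 2) β) (h' : validColl r (n + 2) β') (hU : US β = US β')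
    (hT : TS r n β = TS r n β') : β ⊆ β' := by
  have hinr : ∀ i k, Sum.inr (i, k) ∈ β ↔ Sum.inr (i, k) ∈ β' := by
    intro i k
    rw [valid_Comp hr hn h, valid_Comp hr hn h', hU]
  intro p hp
  rcases p with j | ⟨i, k⟩
  · have hj : j ∈ TS r n β' := hT ▸ mem_TS.2 ⟨_, hp, mem_edges_inl.2 rfl⟩
    obtain ⟨q, hq, hjq⟩ := mem_TS.1 hj
    rcases q with j' | ⟨i, k⟩
    · rw [mem_edges_inl] at hjq
      rwa [hjq]
    · have hd := h.2.1 _ hp _ ((hinr i k).2 hq) (by simp)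
      exact absurd hjq (Finset.disjoint_left.1 hd (mem_edges_inl.2 rfl))
  · exact (hinr i k).1 hp

/-- The pairs of sets in the relation `RR`. -/
noncomputable def pairs (r n : ℕ) : Finset (Finset ℕ × Finset ℕ) :=
  ((Finset.Icc 1 (cN r n)).powerset ×ˢ (Finset.Icc 1 (cN r (n + 1))).powerset).filter
    fun q => RR r n q.1 q.2

theorem mem_pairs {r n : ℕ} {q : Finset ℕ × Finset ℕ} : q ∈ pairs r n ↔ RR r n q.1 q.2 := by
  unfold pairs
  rw [Finset.mem_filter, Finset.mem_product, Finset.mem_powerset, Finset.mem_powerset]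
  exact ⟨fun h => h.2, fun h => ⟨⟨h.1, h.2.1⟩, h⟩⟩

theorem FD_bijOn {r n : ℕ} (hr : 2 ≤ r) (hn : 2 ≤ n) :
    Set.BijOn (fun β => (US β, TS r n β)) (FD r (n + 2)) (pairs r n : Set _) := by
  refine ⟨?_, ?_, ?_⟩
  · intro β hβ
    exact mem_pairs.2 (RR_of_FD hr hn hβ)
  · intro β hβ β' hβ' he
    simp only [Prod.mk.injEq] at he
    exact Finset.Subset.antisymm (FD_inj hr hn hβ.1 hβ'.1 he.1 he.2)
      (FD_inj hr hn hβ'.1 hβ.1 he.1.symm he.2.symm)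
  · rintro ⟨U, T⟩ hq
    have hq' := mem_pairs.1 (Finset.mem_coe.1 hq)
    exact ⟨Binv r n U T, Binv_FD hr hn hq',
      Prod.ext (US_Binv hq'.1) (TS_Binv hr hn hq')⟩

theorem finsum_FD {r n : ℕ} (hr : 2 ≤ r) (hn : 2 ≤ n) (f : ℕ → ℕ → K) :
    ∑ᶠ β ∈ FD r (n + 2), f (B1 β) (B2 r (n + 2) β)
      = ∑ q ∈ pairs r n, f q.1.card q.2.card := by
  rw [← finsum_mem_coe_finset]
  refine finsum_mem_eq_of_bijOn _ (FD_bijOn hr hn) ?_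
  intro β hβ
  rw [B1_eq hr hn hβ.1]
  rfl

/-! ### A counting lemma -/

theorem sum_powerset_pow {R : Type*} [CommRing R] (y : R) (A : Finset ℕ) :
    ∑ U ∈ A.powerset, y ^ U.card = (1 + y) ^ A.card := by
  have := Finset.sum_pow_mul_eq_add_pow y 1 A
  simp only [one_pow, mul_one] at this
  rw [this, add_comm]

theorem counting {R : Type*} [CommRing R] (y : R) (I : ℕ → Finset ℕ) (Bd : Finset ℕ) :
    ∀ A : Finset ℕ, (∀ b ∈ Bd, I b ⊆ A) →
    (∀ b ∈ Bd, ∀ b' ∈ Bd, b ≠ b' → Disjoint (I b) (I b')) →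
    (∀ b ∈ Bd, (I b).Nonempty) →
    (∑ U ∈ A.powerset.filter (fun U => ∀ b ∈ Bd, ¬ I b ⊆ U), y ^ U.card) *
        ∏ b ∈ Bd, (1 + y) ^ (I b).card
      = (1 + y) ^ A.card * ∏ b ∈ Bd, ((1 + y) ^ (I b).card - y ^ (I b).card) := by
  induction Bd using Finset.induction_on with
  | empty => intro A _ _ _; simp [sum_powerset_pow]
  | insert b Bd hb ih =>
    intro A hA hdis hne
    have hA' : ∀ b' ∈ Bd, I b' ⊆ A := fun b' h => hA b' (Finset.mem_insert_of_mem h)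
    have hdis' : ∀ b₁ ∈ Bd, ∀ b₂ ∈ Bd, b₁ ≠ b₂ → Disjoint (I b₁) (I b₂) :=
      fun b₁ h₁ b₂ h₂ => hdis _ (Finset.mem_insert_of_mem h₁) _ (Finset.mem_insert_of_mem h₂)
    have hne' : ∀ b' ∈ Bd, (I b').Nonempty := fun b' h => hne b' (Finset.mem_insert_of_mem h)
    have hbA : I b ⊆ A := hA b (Finset.mem_insert_self _ _)
    have hbd : ∀ b' ∈ Bd, Disjoint (I b') (I b) := fun b' h =>
      hdis _ (Finset.mem_insert_of_mem h) _ (Finset.mem_insert_self _ _)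
        (fun e => hb (e ▸ h))
    have i1 := ih A hA' hdis' hne'
    have i2 := ih (A \ I b)
      (fun b' h => Finset.subset_sdiff.2 ⟨hA' b' h, hbd b' h⟩) hdis' hne'
    have split : (∑ U ∈ A.powerset.filter (fun U => ∀ b' ∈ insert b Bd, ¬ I b' ⊆ U), y ^ U.card)
        = (∑ U ∈ A.powerset.filter (fun U => ∀ b' ∈ Bd, ¬ I b' ⊆ U), y ^ U.card)
          - y ^ (I b).card *
            ∑ U ∈ (A \ I b).powerset.filter (fun U => ∀ b' ∈ Bd, ¬ I b' ⊆ U), y ^ U.card := by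
      rw [eq_sub_iff_add_eq]
      rw [← Finset.sum_filter_add_sum_filter_not
        (A.powerset.filter (fun U => ∀ b' ∈ Bd, ¬ I b' ⊆ U)) (fun U => ¬ I b ⊆ U)]
      congr 1
      · rw [Finset.filter_filter]
        apply Finset.sum_congr _ (fun _ _ => rfl)
        ext U
        simp only [Finset.mem_filter, Finset.forall_mem_insert]
        tauto
      · rw [Finset.mul_sum]
        refine Finset.sum_bij' (fun U _ => U ∪ I b) (fun U _ => U \ I b) ?_ ?_ ?_ ?_ ?_
        · intro U hU
          simp only [Finset.mem_filter, Finset.mem_powerset, not_not] at hU ⊢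
          refine ⟨⟨Finset.union_subset (hU.1.trans Finset.sdiff_subset) hbA, ?_⟩,
            Finset.subset_union_right⟩
          intro b' hb' hsub
          refine hU.2 b' hb' fun x hx => ?_
          rcases Finset.mem_union.1 (hsub hx) with h | h
          · exact h
          · exact absurd h (Finset.disjoint_left.1 (hbd b' hb') hx)
        · intro U hU
          simp only [Finset.mem_filter, Finset.mem_powerset, not_not] at hU ⊢
          refine ⟨Finset.sdiff_subset_sdiff hU.1.1 le_rfl, ?_⟩
          intro b' hb' hsub
          exact hU.1.2 b' hb' (hsub.trans Finset.sdiff_subset)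
        · intro U hU
          simp only [Finset.mem_filter, Finset.mem_powerset] at hU
          have := (Finset.subset_sdiff.1 hU.1).2
          exact Finset.union_sdiff_cancel_right this
        · intro U hU
          simp only [Finset.mem_filter, Finset.mem_powerset, not_not] at hU
          exact Finset.sdiff_union_of_subset hU.2
        · intro U hU
          simp only [Finset.mem_filter, Finset.mem_powerset] at hU
          have := (Finset.subset_sdiff.1 hU.1).2
          rw [Finset.card_union_of_disjoint this, pow_add, mul_comm]
    have hcard : A.card = (A \ I b).card + (I b).card :=
      (Finset.card_sdiff_add_card_eq_card hbA).symm
    rw [Finset.prod_insert hb, Finset.prod_insert hb, split]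
    have e : (1 + y) ^ A.card = (1 + y) ^ (A \ I b).card * (1 + y) ^ (I b).card := by
      rw [hcard, pow_add]
    rw [e] at i1 ⊢
    linear_combination (1 + y) ^ (I b).card * i1 - y ^ (I b).card * (1 + y) ^ (I b).card * i2

/-! ### The fibres over a set `V` of edges of `D_{n+2}` -/

/-- The first bad index. -/
noncomputable def fbf (r n i : ℕ) : ℕ := Classical.epsilon (FB r n i)

/-- The number of preceding edges. -/
noncomputable def Gf (r n i : ℕ) : ℕ :=
  Classical.epsilon fun G => ∃ t, FB r n i t ∧ GR r n ((t : ℤ) - i) G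

theorem fbf_eq {r n i t : ℕ} (h : FB r n i t) : fbf r n i = t :=
  FB_unique (Classical.epsilon_spec (p := FB r n i) ⟨t, h⟩) h

theorem Gf_eq {r n i t G : ℕ} (hr : 2 ≤ r) (h : FB r n i t) (hG : GR r n ((t : ℤ) - i) G) :
    Gf r n i = G := by
  obtain ⟨t', h', hG'⟩ := Classical.epsilon_spec
    (p := fun G => ∃ t, FB r n i t ∧ GR r n ((t : ℤ) - i) G) ⟨G, t, h, hG⟩
  have := FB_unique h h'
  subst this
  exact GR_unique hr hG' hG

/-- Indices of complete blocks contained in `V`. -/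
noncomputable def AA (r n : ℕ) (V : Finset ℕ) : Finset ℕ :=
  (Finset.Icc 1 (cN r n)).filter fun j => ∀ e, v r n (j - 1) < e → e ≤ v r n j → e ∈ V

/-- Constraints for the lower sum. -/
noncomputable def Bd (r n : ℕ) (V : Finset ℕ) : Finset ℕ :=
  (Finset.Icc 1 (cN r n)).filter fun i => ∃ t G, FB r n i t ∧ GR r n ((t : ℤ) - i) G ∧
    (∀ j, i < j → j ≤ t → j ∈ AA r n V) ∧ ∀ e ∈ V, ¬ (v r n i < e + G ∧ e ≤ v r n i)

/-- Edges of `D_{n+3}` outside the blocks of `V`. -/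
noncomputable def BB (r n : ℕ) (V : Finset ℕ) : Finset ℕ :=
  (Finset.Icc 1 (cN r (n + 2))).filter fun e =>
    ∀ j, j + 1 ∈ V → ¬ (v r (n + 1) j < e ∧ e ≤ v r (n + 1) (j + 1))

/-- Constraints for the upper sum. -/
noncomputable def Bd' (r n : ℕ) (V : Finset ℕ) : Finset ℕ :=
  (Finset.Icc 1 (cN r (n + 1))).filter fun i => i ∉ V ∧ ∃ t G, FB r (n + 1) i t ∧
    GR r (n + 1) ((t : ℤ) - i) G ∧ (∀ j, i < j → j ≤ t → j ∈ V) ∧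
    ∀ e, v r (n + 1) i < e + G → e ≤ v r (n + 1) i → e ∈ BB r n V

theorem AA_v_mem {r n : ℕ} (hr : 2 ≤ r) (hn : 2 ≤ n) {V : Finset ℕ} {j : ℕ}
    (h : j ∈ AA r n V) : v r n j ∈ V := by
  unfold AA at h
  rw [Finset.mem_filter, Finset.mem_Icc] at h
  exact h.2 _ (v_strictMono hr hn (by omega)) le_rfl

theorem Bd_v_notMem {r n : ℕ} (hr : 2 ≤ r) {V : Finset ℕ} {i : ℕ}
    (h : i ∈ Bd r n V) : v r n i ∉ V := by
  unfold Bd at h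
  rw [Finset.mem_filter] at h
  obtain ⟨-, t, G, h1, h2, h3, h4⟩ := h
  intro hV
  have := GR_pos hr h2
  exact h4 _ hV ⟨by omega, le_rfl⟩

theorem RR_lower {r n : ℕ} (hr : 2 ≤ r) (hn : 2 ≤ n) {V : Finset ℕ}
    (hV : V ⊆ Finset.Icc 1 (cN r (n + 1))) (U : Finset ℕ) :
    RR r n U V ↔ U ⊆ AA r n V ∧ ∀ i ∈ Bd r n V, ¬ Finset.Ioc i (fbf r n i) ⊆ U := by
  constructor
  · rintro ⟨h1, h2, h3, h4⟩
    have hUA : U ⊆ AA r n V := by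
      intro j hj
      unfold AA
      rw [Finset.mem_filter]
      refine ⟨h1 hj, fun e a b => ?_⟩
      have := Finset.mem_Icc.1 (h1 hj)
      have e1 : j - 1 + 1 = j := by omega
      exact h3 (j - 1) e (by rwa [e1]) a (by rwa [e1])
    refine ⟨hUA, fun i hi hsub => ?_⟩
    have hiU : i ∉ U := fun hh => Bd_v_notMem hr hi (AA_v_mem hr hn (hUA hh))
    unfold Bd at hi
    rw [Finset.mem_filter] at hi
    obtain ⟨-, t, G, f1, f2, f3, f4⟩ := hi
    rw [fbf_eq f1] at hsub
    obtain ⟨e, he, q⟩ := h4 i t G hiU f1 f2 (fun j a b => hsub (Finset.mem_Ioc.2 ⟨a, b⟩))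
    exact f4 e he q
  · rintro ⟨hUA, hB⟩
    refine ⟨hUA.trans (Finset.filter_subset _ _), hV, ?_, ?_⟩
    · intro j e hj a b
      exact (Finset.mem_filter.1 (hUA hj)).2 e a b
    · intro i t G hi f1 f2 f3
      by_contra hcon
      push Not at hcon
      have ht := Finset.mem_Icc.1 (Finset.mem_filter.1 (hUA (f3 t f1.1 le_rfl))).1
      have hit := f1.1
      refine hB i ?_ ?_
      · unfold Bd
        rw [Finset.mem_filter, Finset.mem_Icc]
        refine ⟨⟨FB_pos hr hn f1, by omega⟩, t, G, f1, f2, fun j a b => hUA (f3 j a b), ?_⟩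
        rintro e he ⟨a, b⟩
        have := hcon e he a
        omega
      · rw [fbf_eq f1]
        intro j hj
        rw [Finset.mem_Ioc] at hj
        exact f3 j hj.1 hj.2

theorem RR_upper {r n : ℕ} (hr : 2 ≤ r) (hn : 2 ≤ n) {V T : Finset ℕ}
    (hV : V ⊆ Finset.Icc 1 (cN r (n + 1))) (hT : T ⊆ Finset.Icc 1 (cN r (n + 2))) :
    RR r (n + 1) V T ↔ Finset.Icc 1 (cN r (n + 2)) \ T ⊆ BB r n V ∧
      ∀ i ∈ Bd' r n V, ¬ Finset.Ioc (v r (n + 1) i - Gf r (n + 1) i) (v r (n + 1) i) ⊆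
        Finset.Icc 1 (cN r (n + 2)) \ T := by
  have hn' : 2 ≤ n + 1 := by omega
  have m := v_strictMono hr hn'
  have htop := v_top hr hn'
  rw [show n + 1 + 1 = n + 2 from rfl] at htop
  constructor
  · rintro ⟨h1, h2, h3, h4⟩
    constructor
    · intro e he
      rw [Finset.mem_sdiff] at he
      unfold BB
      rw [Finset.mem_filter]
      refine ⟨he.1, ?_⟩
      rintro j hj ⟨a, b⟩
      exact he.2 (h3 j e hj a b)
    · intro i hi hsub
      unfold Bd' at hi
      rw [Finset.mem_filter] at hi
      obtain ⟨-, hiV, t, G, f1, f2, f3, f4⟩ := hi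
      rw [Gf_eq hr f1 f2] at hsub
      obtain ⟨e, he, a, b⟩ := h4 i t G hiV f1 f2 f3
      have := Finset.mem_Icc.1 (hT he)
      exact (Finset.mem_sdiff.1 (hsub (Finset.mem_Ioc.2 ⟨by omega, b⟩))).2 he
  · rintro ⟨hB, hC⟩
    refine ⟨hV, hT, ?_, ?_⟩
    · intro j e hj a b
      have hj2 := Finset.mem_Icc.1 (hV hj)
      have := m.monotone hj2.2
      by_contra he
      have := hB (Finset.mem_sdiff.2 ⟨Finset.mem_Icc.2 ⟨by omega, by omega⟩, he⟩)
      exact (Finset.mem_filter.1 this).2 j hj ⟨a, b⟩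
    · intro i t G hi f1 f2 f3
      by_contra hcon
      push Not at hcon
      have hit := f1.1
      have ht := Finset.mem_Icc.1 (hV (f3 t hit le_rfl))
      have hle := m.monotone (show i ≤ cN r (n + 1) by omega)
      obtain ⟨G', g1, g2, g3⟩ := FB_GR hr hn' f1
      have hG := GR_unique hr f2 g1
      subst hG
      have hall : ∀ e, v r (n + 1) i < e + G → e ≤ v r (n + 1) i →
          e ∈ Finset.Icc 1 (cN r (n + 2)) \ T := by
        intro e a b
        refine Finset.mem_sdiff.2 ⟨Finset.mem_Icc.2 ⟨by omega, by omega⟩, fun he => ?_⟩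
        have := hcon e he a
        omega
      refine hC i ?_ ?_
      · unfold Bd'
        rw [Finset.mem_filter, Finset.mem_Icc]
        exact ⟨⟨FB_pos hr hn' f1, by omega⟩, hi, t, G, f1, f2, f3,
          fun e a b => hB (hall e a b)⟩
      · rw [Gf_eq hr f1 f2]
        intro e he
        rw [Finset.mem_Ioc] at he
        exact hall e (by omega) he.2

theorem lower_sum {r n : ℕ} (hr : 2 ≤ r) (hn : 2 ≤ n) {V : Finset ℕ}
    (hV : V ⊆ Finset.Icc 1 (cN r (n + 1))) (y : K) :
    (∑ U ∈ (Finset.Icc 1 (cN r n)).powerset.filter (fun U => RR r n U V), y ^ U.card) *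
        ∏ i ∈ Bd r n V, (1 + y) ^ (fbf r n i - i)
      = (1 + y) ^ (AA r n V).card *
        ∏ i ∈ Bd r n V, ((1 + y) ^ (fbf r n i - i) - y ^ (fbf r n i - i)) := by
  have hsub : ∀ b ∈ Bd r n V, Finset.Ioc b (fbf r n b) ⊆ AA r n V := by
    intro b hb
    obtain ⟨-, t, G, f1, f2, f3, f4⟩ := Finset.mem_filter.1 hb
    rw [fbf_eq f1]
    intro j hj
    rw [Finset.mem_Ioc] at hj
    exact f3 j hj.1 hj.2
  have hlt : ∀ b ∈ Bd r n V, ∀ b' ∈ Bd r n V, b < b' →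
      Disjoint (Finset.Ioc b (fbf r n b)) (Finset.Ioc b' (fbf r n b')) := by
    intro b hb b' hb' hbb
    rw [Finset.disjoint_left]
    intro j hj hj'
    rw [Finset.mem_Ioc] at hj hj'
    have := hsub b hb (Finset.mem_Ioc.2 ⟨hbb, by omega⟩)
    exact Bd_v_notMem hr hb' (AA_v_mem hr hn this)
  have := counting y (fun i => Finset.Ioc i (fbf r n i)) (Bd r n V) (AA r n V) hsub
    (by
      intro b hb b' hb' hne
      rcases lt_or_gt_of_ne hne with h | h
      · exact hlt b hb b' hb' h
      · exact (hlt b' hb' b hb h).symm)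
    (by
      intro b hb
      obtain ⟨-, t, G, f1, f2, f3, f4⟩ := Finset.mem_filter.1 hb
      rw [fbf_eq f1]
      exact Finset.nonempty_Ioc.2 f1.1)
  simp only [Nat.card_Ioc] at this
  rw [← this]
  congr 1
  apply Finset.sum_congr _ (fun _ _ => rfl)
  ext U
  simp only [Finset.mem_filter, Finset.mem_powerset]
  rw [RR_lower hr hn hV]
  constructor
  · rintro ⟨-, h⟩; exact h
  · intro h
    exact ⟨h.1.trans (Finset.filter_subset _ _), h⟩

theorem upper_sum {r n : ℕ} (hr : 2 ≤ r) (hn : 2 ≤ n) {V : Finset ℕ}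
    (hV : V ⊆ Finset.Icc 1 (cN r (n + 1))) (y : K) :
    (∑ T ∈ (Finset.Icc 1 (cN r (n + 2))).powerset.filter (fun T => RR r (n + 1) V T),
        y ^ (cN r (n + 2) - T.card)) *
        ∏ i ∈ Bd' r n V, (1 + y) ^ (Gf r (n + 1) i)
      = (1 + y) ^ (BB r n V).card *
        ∏ i ∈ Bd' r n V, ((1 + y) ^ (Gf r (n + 1) i) - y ^ (Gf r (n + 1) i)) := by
  have hn' : 2 ≤ n + 1 := by omega
  have m := v_strictMono hr hn'
  have hG : ∀ b ∈ Bd' r n V, 1 ≤ Gf r (n + 1) b ∧ Gf r (n + 1) b ≤ v r (n + 1) b := by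
    intro b hb
    obtain ⟨-, hiV, t, G, f1, f2, f3, f4⟩ := Finset.mem_filter.1 hb
    obtain ⟨G', g1, g2, g3⟩ := FB_GR hr hn' f1
    rw [Gf_eq hr f1 g1]
    exact ⟨g2, g3⟩
  have hsub : ∀ b ∈ Bd' r n V,
      Finset.Ioc (v r (n + 1) b - Gf r (n + 1) b) (v r (n + 1) b) ⊆ BB r n V := by
    intro b hb
    have hGb := hG b hb
    obtain ⟨-, hiV, t, G, f1, f2, f3, f4⟩ := Finset.mem_filter.1 hb
    rw [Gf_eq hr f1 f2] at *
    intro e he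
    rw [Finset.mem_Ioc] at he
    exact f4 e (by omega) he.2
  have hlt : ∀ b ∈ Bd' r n V, ∀ b' ∈ Bd' r n V, b < b' →
      Disjoint (Finset.Ioc (v r (n + 1) b - Gf r (n + 1) b) (v r (n + 1) b))
        (Finset.Ioc (v r (n + 1) b' - Gf r (n + 1) b') (v r (n + 1) b')) := by
    intro b hb b' hb' hbb
    rw [Finset.disjoint_left]
    intro e he he'
    rw [Finset.mem_Ioc] at he he'
    have h1 := m hbb
    have h2 : v r (n + 1) b + 1 ∈ BB r n V := hsub b' hb' (Finset.mem_Ioc.2 ⟨by omega, by omega⟩)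
    obtain ⟨-, hiV, t, G, f1, f2, f3, f4⟩ := Finset.mem_filter.1 hb
    have h3 := f3 (b + 1) (by omega) f1.1
    have h4 := m (show b < b + 1 by omega)
    exact (Finset.mem_filter.1 h2).2 b h3 ⟨by omega, by omega⟩
  have := counting y (fun i => Finset.Ioc (v r (n + 1) i - Gf r (n + 1) i) (v r (n + 1) i))
    (Bd' r n V) (BB r n V) hsub
    (by
      intro b hb b' hb' hne
      rcases lt_or_gt_of_ne hne with h | h
      · exact hlt b hb b' hb' h
      · exact (hlt b' hb' b hb h).symm)
    (by
      intro b hb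
      have := hG b hb
      exact Finset.nonempty_Ioc.2 (by omega))
  simp only [Nat.card_Ioc] at this
  have hcard : ∀ b ∈ Bd' r n V,
      v r (n + 1) b - (v r (n + 1) b - Gf r (n + 1) b) = Gf r (n + 1) b := by
    intro b hb
    have := hG b hb
    omega
  have hp1 : ∏ b ∈ Bd' r n V, (1 + y) ^ (v r (n + 1) b - (v r (n + 1) b - Gf r (n + 1) b)) =
      ∏ b ∈ Bd' r n V, (1 + y) ^ (Gf r (n + 1) b) :=
    Finset.prod_congr rfl (fun b hb => by rw [hcard b hb])
  have hp2 : ∏ b ∈ Bd' r n V, ((1 + y) ^ (v r (n + 1) b - (v r (n + 1) b - Gf r (n + 1) b)) -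
        y ^ (v r (n + 1) b - (v r (n + 1) b - Gf r (n + 1) b))) =
      ∏ b ∈ Bd' r n V, ((1 + y) ^ (Gf r (n + 1) b) - y ^ (Gf r (n + 1) b)) :=
    Finset.prod_congr rfl (fun b hb => by rw [hcard b hb])
  rw [hp1, hp2] at this
  rw [← this]
  congr 1
  have hBB : BB r n V ⊆ Finset.Icc 1 (cN r (n + 2)) := Finset.filter_subset _ _
  refine Finset.sum_bij' (fun T _ => Finset.Icc 1 (cN r (n + 2)) \ T)
    (fun S _ => Finset.Icc 1 (cN r (n + 2)) \ S) ?_ ?_ ?_ ?_ ?_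
  · intro T hT
    rw [Finset.mem_filter, Finset.mem_powerset] at hT
    rw [Finset.mem_filter, Finset.mem_powerset]
    exact (RR_upper hr hn hV hT.1).1 hT.2
  · intro S hS
    rw [Finset.mem_filter, Finset.mem_powerset] at hS
    rw [Finset.mem_filter, Finset.mem_powerset]
    refine ⟨Finset.sdiff_subset, ?_⟩
    rw [RR_upper hr hn hV Finset.sdiff_subset,
      Finset.sdiff_sdiff_eq_self (hS.1.trans hBB)]
    exact hS
  · intro T hT
    rw [Finset.mem_filter, Finset.mem_powerset] at hT
    exact Finset.sdiff_sdiff_eq_self hT.1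
  · intro S hS
    rw [Finset.mem_filter, Finset.mem_powerset] at hS
    exact Finset.sdiff_sdiff_eq_self (hS.1.trans hBB)
  · intro T hT
    rw [Finset.mem_filter, Finset.mem_powerset] at hT
    rw [Finset.card_sdiff_of_subset hT.1, Nat.card_Icc]
    rfl

/-! ### The fibre identity -/

theorem blocks_iff {r n : ℕ} (hr : 2 ≤ r) (hn : 2 ≤ n) {V : Finset ℕ}
    (hV : V ⊆ Finset.Icc 1 (cN r (n + 1))) {i t : ℕ} (hit : i < t) :
    (∀ j, v r n i < j → j ≤ v r n t → j ∈ V) ↔ ∀ j, i < j → j ≤ t → j ∈ AA r n V := by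
  have m := v_strictMono hr hn
  constructor
  · intro h j h1 h2
    have ht := Finset.mem_Icc.1 (hV (h _ (m hit) le_rfl))
    rw [← v_top hr hn] at ht
    have ht2 := m.le_iff_le.1 ht.2
    unfold AA
    rw [Finset.mem_filter, Finset.mem_Icc]
    refine ⟨⟨by omega, by omega⟩, fun e a b => h e ?_ ?_⟩
    · have := m.monotone (show i ≤ j - 1 by omega)
      omega
    · have := m.monotone h2
      omega
  · intro h e h1 h2
    obtain ⟨k, k1, k2⟩ := exists_block hr hn (e - 1)
    have a1 : i < k + 1 := m.lt_iff_lt.1 (by omega)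
    have a2 : k < t := m.lt_iff_lt.1 (by omega)
    have := h (k + 1) a1 a2
    unfold AA at this
    rw [Finset.mem_filter] at this
    exact this.2 e (by rw [Nat.add_sub_cancel]; omega) (by omega)

theorem window_iff {r n : ℕ} (hr : 2 ≤ r) (hn : 2 ≤ n) {V : Finset ℕ}
    (hV : V ⊆ Finset.Icc 1 (cN r (n + 1))) {i L G : ℕ} (hi : i ≤ cN r n)
    (hGR : GR r n L G) (hG : G ≤ v r n i) :
    (∀ e, v r (n + 1) (v r n i) < e + L → e ≤ v r (n + 1) (v r n i) → e ∈ BB r n V) ↔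
      ∀ e ∈ V, ¬ (v r n i < e + G ∧ e ≤ v r n i) := by
  have m := v_strictMono hr hn
  have m' := v_strictMono hr (show 2 ≤ n + 1 by omega)
  obtain ⟨g1, g2⟩ := geo hr hn hGR hG
  constructor
  · rintro h e he ⟨a, b⟩
    have he1 := Finset.mem_Icc.1 (hV he)
    have b1 := m'.monotone (show v r n i - G + 1 ≤ e by omega)
    have b2 := m'.monotone b
    have := h (v r (n + 1) e) (by omega) b2
    unfold BB at this
    rw [Finset.mem_filter] at this
    have e1 : e - 1 + 1 = e := by omega
    refine this.2 (e - 1) (by rwa [e1]) ⟨m' (by omega), by rw [e1]⟩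
  · intro h e a b
    unfold BB
    rw [Finset.mem_filter, Finset.mem_Icc]
    have b1 := m'.monotone (m.monotone hi)
    rw [v_top hr hn, v_top hr (show 2 ≤ n + 1 by omega)] at b1
    refine ⟨⟨by omega, b.trans b1⟩, ?_⟩
    rintro j hj ⟨j1, j2⟩
    have c1 : j < v r n i := m'.lt_iff_lt.1 (by omega)
    have c2 : v r n i - G < j + 1 := m'.lt_iff_lt.1 (by omega)
    exact h _ hj ⟨by omega, by omega⟩

theorem mem_Bd_iff {r n : ℕ} (hr : 2 ≤ r) (hn : 2 ≤ n) {V : Finset ℕ}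
    (hV : V ⊆ Finset.Icc 1 (cN r (n + 1))) (i : ℕ) :
    i ∈ Bd r n V ↔ v r n i ∈ Bd' r n V := by
  have m := v_strictMono hr hn
  constructor
  · intro h
    have hnot := Bd_v_notMem hr h
    unfold Bd at h
    rw [Finset.mem_filter, Finset.mem_Icc] at h
    obtain ⟨⟨i1, i2⟩, t, G, f1, f2, f3, f4⟩ := h
    have hit := f1.1
    obtain ⟨G', g1, g2, g3⟩ := FB_GR hr hn f1
    obtain rfl := GR_unique hr f2 g1
    have f2' : GR r n ((t - i : ℕ) : ℤ) G := by
      rwa [Nat.cast_sub hit.le]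
    unfold Bd'
    rw [Finset.mem_filter, Finset.mem_Icc]
    refine ⟨⟨?_, ?_⟩, hnot, v r n t, t - i, FB_vertex hr hn f1, GR_vertex hr hn f1,
      (blocks_iff hr hn hV hit).2 f3, (window_iff hr hn hV i2 f2' g3).2 f4⟩
    · have := m.le_apply (x := i)
      omega
    · rw [← v_top hr hn]
      exact m.monotone i2
  · intro h
    unfold Bd' at h
    rw [Finset.mem_filter, Finset.mem_Icc] at h
    obtain ⟨⟨i1, i2⟩, hnot, t', G, f1, f2, f3, f4⟩ := h
    obtain ⟨t, rfl, k1⟩ := FB_vertex_inv hr hn f1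
    obtain rfl := GR_unique hr f2 (GR_vertex hr hn k1)
    have hit := k1.1
    rw [← v_top hr hn] at i2
    have i3 := m.le_iff_le.1 i2
    obtain ⟨G', g1, g2, g3⟩ := FB_GR hr hn k1
    have f2' : GR r n ((t - i : ℕ) : ℤ) G' := by
      rwa [Nat.cast_sub hit.le]
    unfold Bd
    rw [Finset.mem_filter, Finset.mem_Icc]
    exact ⟨⟨FB_pos hr hn k1, i3⟩, t, G', k1, g1, (blocks_iff hr hn hV hit).1 f3,
      (window_iff hr hn hV i3 f2' g3).1 f4⟩

/-- Vertical edges in `V`. -/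
noncomputable def WW (r n : ℕ) (V : Finset ℕ) : Finset ℕ :=
  (Finset.Icc 1 (cN r n)).filter fun j => v r n j ∈ V

/-- Constraints at non-vertical edges. -/
noncomputable def BdA (r n : ℕ) (V : Finset ℕ) : Finset ℕ :=
  (Bd' r n V).filter fun i => ¬ ∃ k, v r n k = i

theorem mem_BdA {r n : ℕ} (hr : 2 ≤ r) (hn : 2 ≤ n) {V : Finset ℕ}
    (hV : V ⊆ Finset.Icc 1 (cN r (n + 1))) {i k : ℕ} (h1 : v r n k ≤ i)
    (h2 : i < v r n (k + 1)) :
    i ∈ BdA r n V ↔ i ∉ V ∧ v r n k < i ∧ ∀ j, i < j → j ≤ v r n (k + 1) → j ∈ V := by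
  have m := v_strictMono hr hn
  have m' := v_strictMono hr (show 2 ≤ n + 1 by omega)
  unfold BdA Bd'
  rw [Finset.mem_filter, Finset.mem_filter, Finset.mem_Icc]
  constructor
  · rintro ⟨⟨a, b, t, G, f1, f2, f3, f4⟩, hk⟩
    have hlt : v r n k < i := lt_of_le_of_ne h1 fun e => hk ⟨k, e⟩
    obtain rfl := FB_unique f1 (FB_nonvertex hr hn hlt h2)
    exact ⟨b, hlt, f3⟩
  · rintro ⟨a, b, d⟩
    have htop := Finset.mem_Icc.1 (hV (d _ h2 le_rfl))
    refine ⟨⟨⟨by omega, by omega⟩, a, _, 1, FB_nonvertex hr hn b h2,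
      GR_nonvertex hr hn b h2, d, ?_⟩, ?_⟩
    · intro e e1 e2
      have : e = v r (n + 1) i := by omega
      subst this
      unfold BB
      rw [Finset.mem_filter, Finset.mem_Icc]
      have b1 := m'.monotone (show i ≤ cN r (n + 1) by omega)
      rw [v_top hr (show 2 ≤ n + 1 by omega)] at b1
      have b2 := m'.le_apply (x := i)
      refine ⟨⟨by omega, b1⟩, ?_⟩
      rintro j hj ⟨j1, j2⟩
      have j3 := m'.lt_iff_lt.1 j1
      have j4 := m'.le_iff_le.1 j2
      have : i = j + 1 := by omega
      exact a (this ▸ hj)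
    · rintro ⟨q, rfl⟩
      have := m.lt_iff_lt.1 b
      have := m.lt_iff_lt.1 h2
      omega

theorem card_WW {r n : ℕ} (hr : 2 ≤ r) (hn : 2 ≤ n) {V : Finset ℕ}
    (hV : V ⊆ Finset.Icc 1 (cN r (n + 1))) :
    (AA r n V).card + (BdA r n V).card = (WW r n V).card := by
  have m := v_strictMono hr hn
  choose blk hb1 hb2 using exists_block hr hn
  have huniq : ∀ e k, v r n k ≤ e → e < v r n (k + 1) → blk e = k := by
    intro e k h1 h2
    have a := m.lt_iff_lt.1 ((hb1 e).trans_lt h2)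
    have b := m.lt_iff_lt.1 (h1.trans_lt (hb2 e))
    omega
  have hsub : AA r n V ⊆ WW r n V := by
    intro j hj
    unfold WW
    rw [Finset.mem_filter]
    exact ⟨(Finset.mem_filter.1 hj).1, AA_v_mem hr hn hj⟩
  have hc : (BdA r n V).card = (WW r n V \ AA r n V).card := by
    refine Finset.card_bij (fun i _ => blk i + 1) ?_ ?_ ?_
    · intro i hi
      rw [mem_BdA hr hn hV (hb1 i) (hb2 i)] at hi
      obtain ⟨h1, h2, h3⟩ := hi
      have hv := h3 _ (hb2 i) le_rfl
      have hv2 := Finset.mem_Icc.1 (hV hv)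
      rw [← v_top hr hn] at hv2
      have hv3 := m.le_iff_le.1 hv2.2
      rw [Finset.mem_sdiff]
      constructor
      · unfold WW
        rw [Finset.mem_filter, Finset.mem_Icc]
        exact ⟨⟨by omega, hv3⟩, hv⟩
      · intro hA
        unfold AA at hA
        rw [Finset.mem_filter] at hA
        exact h1 (hA.2 i (by rwa [Nat.add_sub_cancel]) (hb2 i).le)
    · intro i hi i' hi' he
      rw [mem_BdA hr hn hV (hb1 i) (hb2 i)] at hi
      rw [mem_BdA hr hn hV (hb1 i') (hb2 i')] at hi'
      rcases lt_trichotomy i i' with h | h | h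
      · exact absurd (hi.2.2 i' h (by rw [he]; exact (hb2 i').le)) hi'.1
      · exact h
      · exact absurd (hi'.2.2 i h (by rw [← he]; exact (hb2 i).le)) hi.1
    · intro j hj
      rw [Finset.mem_sdiff] at hj
      obtain ⟨hW, hA⟩ := hj
      unfold WW at hW
      rw [Finset.mem_filter] at hW
      have hj1 := Finset.mem_Icc.1 hW.1
      have hex : ((Finset.Ioc (v r n (j - 1)) (v r n j)).filter (· ∉ V)).Nonempty := by
        by_contra hne
        rw [Finset.not_nonempty_iff_eq_empty, Finset.filter_eq_empty_iff] at hne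
        apply hA
        unfold AA
        rw [Finset.mem_filter]
        refine ⟨hW.1, fun e a b => ?_⟩
        have := hne (Finset.mem_Ioc.2 ⟨a, b⟩)
        simpa using this
      obtain ⟨e, he, hmax⟩ := Finset.exists_max_image _ id hex
      rw [Finset.mem_filter, Finset.mem_Ioc] at he
      have hne : e ≠ v r n j := fun h => he.2 (h ▸ hW.2)
      have e1 : j - 1 + 1 = j := by omega
      have hlt : e < v r n (j - 1 + 1) := by rw [e1]; omega
      have hbe := huniq e (j - 1) he.1.1.le hlt
      refine ⟨e, ?_, by omega⟩
      rw [mem_BdA hr hn hV he.1.1.le hlt]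
      refine ⟨he.2, he.1.1, fun q q1 q2 => ?_⟩
      rw [e1] at q2
      by_contra hq
      have := hmax q (Finset.mem_filter.2 ⟨Finset.mem_Ioc.2 ⟨by omega, q2⟩, hq⟩)
      simp only [id] at this
      omega
  rw [hc, add_comm]
  exact Finset.card_sdiff_add_card_eq_card hsub

theorem card_BB {r n : ℕ} (hr : 2 ≤ r) (hn : 2 ≤ n) {V : Finset ℕ}
    (hV : V ⊆ Finset.Icc 1 (cN r (n + 1))) :
    (BB r n V).card + r * V.card = cN r (n + 2) + (WW r n V).card := by
  classical
  have m := v_strictMono hr hn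
  have m' := v_strictMono hr (show 2 ≤ n + 1 by omega)
  have hBB : BB r n V = Finset.Icc 1 (cN r (n + 2)) \
      V.biUnion fun j => Finset.Ioc (v r (n + 1) (j - 1)) (v r (n + 1) j) := by
    ext e
    unfold BB
    rw [Finset.mem_filter, Finset.mem_sdiff, Finset.mem_biUnion]
    refine and_congr_right fun he => ?_
    constructor
    · rintro h ⟨j, hj, hje⟩
      have := Finset.mem_Icc.1 (hV hj)
      have e1 : j - 1 + 1 = j := by omega
      exact h (j - 1) (by rwa [e1]) (by rw [e1]; exact Finset.mem_Ioc.1 hje)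
    · intro h j hj hje
      exact h ⟨j + 1, hj, Finset.mem_Ioc.2 hje⟩
  have hsub : (V.biUnion fun j => Finset.Ioc (v r (n + 1) (j - 1)) (v r (n + 1) j)) ⊆
      Finset.Icc 1 (cN r (n + 2)) := by
    intro e he
    rw [Finset.mem_biUnion] at he
    obtain ⟨j, hj, he⟩ := he
    rw [Finset.mem_Ioc] at he
    have b1 := m'.monotone (Finset.mem_Icc.1 (hV hj)).2
    rw [v_top hr (show 2 ≤ n + 1 by omega)] at b1
    exact Finset.mem_Icc.2 ⟨by omega, he.2.trans b1⟩
  have hcard := Finset.card_sdiff_add_card_eq_card hsub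
  rw [← hBB, Nat.card_Icc, Nat.add_sub_cancel, Finset.card_biUnion] at hcard
  · have hstep : ∀ j ∈ V, (Finset.Ioc (v r (n + 1) (j - 1)) (v r (n + 1) j)).card +
        (if ∃ k, v r n k = j then 1 else 0) = r := by
      intro j hj
      have hj1 := Finset.mem_Icc.1 (hV hj)
      rw [Nat.card_Ioc]
      obtain ⟨k, k1, k2⟩ := exists_block hr hn (j - 1)
      have a1 := v_next hr hn k1 k2
      have a3 := m' (show j - 1 < j by omega)
      push_cast [hj1.1] at a1
      split_ifs with h
      · obtain ⟨q, rfl⟩ := h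
        have q1 : k < q := m.lt_iff_lt.1 (by omega)
        have q2 : q ≤ k + 1 := by
          by_contra hcon
          have := m (show k + 1 < q by omega)
          omega
        obtain rfl : q = k + 1 := by omega
        have a2 := v_next_v hr hn (k + 1)
        push_cast at a2
        zify [a3.le]
        linarith
      · have : j < v r n (k + 1) := by
          by_contra hcon
          exact h ⟨k + 1, by omega⟩
        have a2 := v_next hr hn (t := j) (by omega) this
        zify [a3.le]
        linarith
    have hsum := Finset.sum_congr rfl hstep
    rw [Finset.sum_add_distrib, Finset.sum_const, smul_eq_mul, ← Finset.card_filter] at hsum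
    have himg : V.filter (fun j => ∃ k, v r n k = j) = (WW r n V).image (v r n) := by
      ext j
      unfold WW
      simp only [Finset.mem_filter, Finset.mem_image, Finset.mem_Icc]
      constructor
      · rintro ⟨hj, k, rfl⟩
        have hj1 := Finset.mem_Icc.1 (hV hj)
        refine ⟨k, ⟨⟨?_, ?_⟩, hj⟩, rfl⟩
        · by_contra hk
          have : k = 0 := by omega
          rw [this, v_zero hr hn] at hj1
          omega
        · rw [← v_top hr hn] at hj1
          exact m.le_iff_le.1 hj1.2
      · rintro ⟨k, ⟨-, hk⟩, rfl⟩
        exact ⟨hk, k, rfl⟩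
    rw [himg, Finset.card_image_of_injective _ m.injective] at hsum
    rw [mul_comm r]
    omega
  · intro j hj j' hj' hne
    have key : ∀ a ∈ V, ∀ b ∈ V, a < b →
        Disjoint (Finset.Ioc (v r (n + 1) (a - 1)) (v r (n + 1) a))
          (Finset.Ioc (v r (n + 1) (b - 1)) (v r (n + 1) b)) := by
      intro a ha b hb hab
      rw [Finset.disjoint_left]
      intro e he he'
      rw [Finset.mem_Ioc] at he he'
      have := m'.monotone (show a ≤ b - 1 by omega)
      omega
    rcases lt_or_gt_of_ne hne with h | h
    · exact key j hj j' hj' h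
    · exact (key j' hj' j hj h).symm

theorem fiber {r n : ℕ} (hr : 2 ≤ r) (hn : 2 ≤ n) {V : Finset ℕ}
    (hV : V ⊆ Finset.Icc 1 (cN r (n + 1))) (y : K) (hy : 1 + y ≠ 0) :
    (∑ T ∈ (Finset.Icc 1 (cN r (n + 2))).powerset.filter (fun T => RR r (n + 1) V T),
        y ^ (cN r (n + 2) - T.card)) =
      (∑ U ∈ (Finset.Icc 1 (cN r n)).powerset.filter (fun U => RR r n U V), y ^ U.card) *
        (1 + y) ^ (c r (n + 2) - (r : ℤ) * V.card) := by
  have m := v_strictMono hr hn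
  have hlow := lower_sum hr hn hV y
  have hup := upper_sum hr hn hV y
  have hfil : (Bd' r n V).filter (fun i => ∃ k, v r n k = i) = (Bd r n V).image (v r n) := by
    ext i
    simp only [Finset.mem_filter, Finset.mem_image]
    constructor
    · rintro ⟨h, k, rfl⟩
      exact ⟨k, (mem_Bd_iff hr hn hV k).2 h, rfl⟩
    · rintro ⟨k, h, rfl⟩
      exact ⟨(mem_Bd_iff hr hn hV k).1 h, k, rfl⟩
  have hprod : ∀ f : ℕ → K, ∏ i ∈ Bd' r n V, f (Gf r (n + 1) i) =
      (∏ i ∈ Bd r n V, f (fbf r n i - i)) * f 1 ^ (BdA r n V).card := by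
    intro f
    rw [← Finset.prod_filter_mul_prod_filter_not (Bd' r n V) (fun i => ∃ k, v r n k = i), hfil,
      Finset.prod_image (fun a _ b _ h => m.injective h)]
    congr 1
    · refine Finset.prod_congr rfl fun i hi => ?_
      obtain ⟨-, t, G, f1, f2, f3, f4⟩ := Finset.mem_filter.1 hi
      rw [Gf_eq hr (FB_vertex hr hn f1) (GR_vertex hr hn f1), fbf_eq f1]
    · rw [← Finset.prod_const]
      refine Finset.prod_congr rfl fun i hi => ?_
      obtain ⟨k, k1, k2⟩ := exists_block hr hn i
      obtain ⟨-, h2, -⟩ := (mem_BdA hr hn hV k1 k2).1 hi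
      rw [Gf_eq hr (FB_nonvertex hr hn h2 k2) (GR_nonvertex hr hn h2 k2)]
  have h1 := hprod (fun g => (1 + y) ^ g)
  have h2 := hprod (fun g => (1 + y) ^ g - y ^ g)
  simp only [pow_one, add_sub_cancel_right, one_pow, mul_one] at h1 h2
  rw [h1, h2] at hup
  set Rs := ∑ T ∈ (Finset.Icc 1 (cN r (n + 2))).powerset.filter (fun T => RR r (n + 1) V T),
        y ^ (cN r (n + 2) - T.card)
  set Ls := ∑ U ∈ (Finset.Icc 1 (cN r n)).powerset.filter (fun U => RR r n U V), y ^ U.card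
  set P := ∏ i ∈ Bd r n V, (1 + y) ^ (fbf r n i - i) with hP
  have hP0 : P ≠ 0 := Finset.prod_ne_zero_iff.2 fun i _ => pow_ne_zero _ hy
  have hc1 := card_WW hr hn hV
  have hc2 := card_BB hr hn hV
  have hmain : Rs * (1 + y) ^ (WW r n V).card = Ls * (1 + y) ^ (BB r n V).card := by
    apply mul_right_cancel₀ hP0
    rw [← hc1, pow_add]
    linear_combination (1 + y) ^ (AA r n V).card * hup - (1 + y) ^ (BB r n V).card * hlow
  have hexp : c r (n + 2) - (r : ℤ) * V.card = ((BB r n V).card : ℤ) - (WW r n V).card := by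
    rw [← cN_cast hr (show 1 ≤ n + 2 by omega)]
    have : (((BB r n V).card + r * V.card : ℕ) : ℤ) = ((cN r (n + 2) + (WW r n V).card : ℕ) : ℤ) :=
      by rw [hc2]
    push_cast at this
    linarith
  rw [hexp, zpow_sub₀ hy, zpow_natCast, zpow_natCast, ← mul_div_assoc, ← hmain,
    mul_div_assoc, div_self (pow_ne_zero _ hy), mul_one]

/-! ### The recursion for the generating functions -/

/-- The right hand side of the expansion formula. -/
noncomputable def Phi (r n : ℕ) (a b : K) : K :=
  a ^ (-(c r (n + 1))) * b ^ (-(c r n)) *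
    ∑ q ∈ pairs r n,
      a ^ ((r : ℤ) * (q.1.card : ℤ)) * b ^ ((r : ℤ) * (c r (n + 1) - (q.2.card : ℤ)))

theorem Phi_step {r n : ℕ} (hr : 2 ≤ r) (hn : 2 ≤ n) {a b d : K} (ha : a ≠ 0) (hb : b ≠ 0)
    (hd : d ≠ 0) (h : a * d = b ^ r + 1) : Phi r (n + 1) a b = Phi r n b d := by
  have hy : 1 + b ^ r = a * d := by rw [h, add_comm]
  have hy0 : 1 + b ^ r ≠ 0 := by rw [hy]; exact mul_ne_zero ha hd
  have hcN := cN_cast hr (show 1 ≤ n + 2 by omega)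
  have hL : ∑ q ∈ pairs r (n + 1),
      a ^ ((r : ℤ) * (q.1.card : ℤ)) * b ^ ((r : ℤ) * (c r (n + 1 + 1) - (q.2.card : ℤ))) =
      ∑ V ∈ (Finset.Icc 1 (cN r (n + 1))).powerset, a ^ ((r : ℤ) * (V.card : ℤ)) *
        ∑ T ∈ (Finset.Icc 1 (cN r (n + 2))).powerset.filter (fun T => RR r (n + 1) V T),
          (b ^ r) ^ (cN r (n + 2) - T.card) := by
    unfold pairs
    rw [Finset.sum_filter, Finset.sum_product]
    refine Finset.sum_congr rfl fun V _ => ?_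
    rw [Finset.sum_filter, Finset.mul_sum]
    refine Finset.sum_congr rfl fun T hT => ?_
    split_ifs
    · congr 1
      have hcard := Finset.card_le_card (Finset.mem_powerset.1 hT)
      rw [Nat.card_Icc, Nat.add_sub_cancel] at hcard
      rw [← hcN, ← pow_mul, ← zpow_natCast]
      push_cast [hcard]
      rfl
    · rw [mul_zero]
  have hR : ∑ q ∈ pairs r n,
      b ^ ((r : ℤ) * (q.1.card : ℤ)) * d ^ ((r : ℤ) * (c r (n + 1) - (q.2.card : ℤ))) =
      ∑ V ∈ (Finset.Icc 1 (cN r (n + 1))).powerset,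
        (∑ U ∈ (Finset.Icc 1 (cN r n)).powerset.filter (fun U => RR r n U V),
          (b ^ r) ^ U.card) * d ^ ((r : ℤ) * (c r (n + 1) - (V.card : ℤ))) := by
    unfold pairs
    rw [Finset.sum_filter, Finset.sum_product_right]
    refine Finset.sum_congr rfl fun V _ => ?_
    rw [Finset.sum_filter, Finset.sum_mul]
    refine Finset.sum_congr rfl fun U hU => ?_
    split_ifs
    · congr 1
      rw [← pow_mul, ← zpow_natCast]
      push_cast
      rfl
    · rw [zero_mul]
  unfold Phi
  rw [hL, hR, Finset.mul_sum, Finset.mul_sum]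
  refine Finset.sum_congr rfl fun V hV => ?_
  rw [fiber hr hn (Finset.mem_powerset.1 hV) (b ^ r) hy0, hy, mul_zpow]
  generalize (∑ U ∈ (Finset.Icc 1 (cN r n)).powerset.filter (fun U => RR r n U V),
          (b ^ r) ^ U.card) = S
  have e1 : (r : ℤ) * (c r (n + 1) - (V.card : ℤ)) = c r n + (c r (n + 2) - (r : ℤ) * V.card) := by
    rw [c_add_two]
    ring
  rw [e1, zpow_add₀ hd, show n + 1 + 1 = n + 2 from rfl]
  have e2 : a ^ (-c r (n + 2)) * a ^ ((r : ℤ) * (V.card : ℤ)) *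
      a ^ (c r (n + 2) - (r : ℤ) * V.card) = 1 := by
    rw [← zpow_add₀ ha, ← zpow_add₀ ha]
    have : -c r (n + 2) + (r : ℤ) * (V.card : ℤ) + (c r (n + 2) - (r : ℤ) * V.card) = 0 := by ring
    rw [this, zpow_zero]
  have e3 : d ^ (-c r n) * d ^ (c r n) = 1 := by
    rw [← zpow_add₀ hd, neg_add_cancel, zpow_zero]
  linear_combination (b ^ (-c r (n + 1)) * S * d ^ (c r (n + 2) - (r : ℤ) * V.card)) * (e2 - e3)

theorem Phi_base {r : ℕ} (hr : 2 ≤ r) {a b d f : K} (ha : a ≠ 0) (hb : b ≠ 0)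
    (h : a * d = b ^ r + 1) (h' : b * f = d ^ r + 1) : Phi r 2 a b = f := by
  have c2 : cN r 2 = 1 := by
    have := cN_cast hr (show 1 ≤ 2 by omega)
    rw [c_two] at this
    exact_mod_cast this
  have c3 : cN r 3 = r := by
    have := cN_cast hr (show 1 ≤ 3 by omega)
    rw [c_three] at this
    exact_mod_cast this
  have hv1 : v r 2 1 = r := by
    have := v_top hr (show 2 ≤ 2 by omega)
    rwa [c2, c3] at this
  have hv0 := v_zero hr (show 2 ≤ 2 by omega)
  have hRR0 : ∀ T ∈ (Finset.Icc 1 r).powerset, RR r 2 ∅ T := by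
    intro T hT
    refine ⟨Finset.empty_subset _, ?_, ?_, ?_⟩
    · rw [show 2 + 1 = 3 from rfl, c3]
      exact Finset.mem_powerset.1 hT
    · intro j e hj
      simp at hj
    · intro i t G _ hF
      exact absurd hF (FB_two hr)
  have hRR1 : ∀ T ∈ (Finset.Icc 1 r).powerset, (RR r 2 {1} T ↔ T = Finset.Icc 1 r) := by
    intro T hT
    rw [Finset.mem_powerset] at hT
    constructor
    · rintro ⟨-, -, h3, -⟩
      refine Finset.Subset.antisymm hT fun e he => ?_
      rw [Finset.mem_Icc] at he
      exact h3 0 e (by simp) (by omega) (by rw [zero_add, hv1]; exact he.2)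
    · rintro rfl
      refine ⟨by rw [c2]; simp, by rw [show 2 + 1 = 3 from rfl, c3], ?_, ?_⟩
      · intro j e hj h1 h2
        have : j = 0 := by simpa using hj
        subst this
        rw [zero_add, hv1] at h2
        exact Finset.mem_Icc.2 ⟨by omega, h2⟩
      · intro i t G _ hF
        exact absurd hF (FB_two hr)
  have hsum : ∑ q ∈ pairs r 2,
      a ^ ((r : ℤ) * (q.1.card : ℤ)) * b ^ ((r : ℤ) * (c r (2 + 1) - (q.2.card : ℤ))) =
      (b ^ r + 1) ^ r + a ^ r := by
    unfold pairs
    rw [Finset.sum_filter, Finset.sum_product, show 2 + 1 = 3 from rfl, c3, c2,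
      Finset.Icc_self, show ({1} : Finset ℕ).powerset = {∅, {1}} from rfl, Finset.sum_pair (by simp), c_three]
    congr 1
    · have hp := Finset.sum_pow_mul_eq_add_pow (1 : K) (b ^ r) (Finset.Icc 1 r)
      rw [Nat.card_Icc, Nat.add_sub_cancel] at hp
      rw [add_comm (b ^ r) 1, ← hp]
      refine Finset.sum_congr rfl fun T hT => ?_
      rw [if_pos (hRR0 T hT)]
      have hcard := Finset.card_le_card (Finset.mem_powerset.1 hT)
      rw [Nat.card_Icc, Nat.add_sub_cancel] at hcard
      rw [← pow_mul, ← zpow_natCast b]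
      push_cast [hcard]
      simp
    · rw [Finset.sum_eq_single (Finset.Icc 1 r)]
      · rw [if_pos ((hRR1 _ (by simp)).2 rfl)]
        simp
      · intro T hT hne
        rw [if_neg]
        exact fun hh => hne ((hRR1 T hT).1 hh)
      · intro hh
        simp at hh
  unfold Phi
  rw [hsum, ← h, mul_pow, c_two, show 2 + 1 = 3 from rfl, c_three, zpow_neg, zpow_neg, zpow_one,
    zpow_natCast]
  have har := pow_ne_zero r ha
  have : a ^ r * d ^ r + a ^ r = a ^ r * (b * f) := by rw [h']; ring
  rw [this]
  field_simp

/-- Quotients of polynomials which are positive at `(1,1)`. -/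
def IsPos (z : K) : Prop :=
  ∃ p q : MvPolynomial (Fin 2) ℚ, 0 < MvPolynomial.eval (fun _ => (1 : ℚ)) p ∧
    0 < MvPolynomial.eval (fun _ => (1 : ℚ)) q ∧
    z * algebraMap (MvPolynomial (Fin 2) ℚ) K q = algebraMap (MvPolynomial (Fin 2) ℚ) K p

theorem map_ne_zero_of_pos {p : MvPolynomial (Fin 2) ℚ}
    (h : 0 < MvPolynomial.eval (fun _ => (1 : ℚ)) p) :
    algebraMap (MvPolynomial (Fin 2) ℚ) K p ≠ 0 := by
  intro h0
  have : p = 0 := by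
    apply IsFractionRing.injective (MvPolynomial (Fin 2) ℚ) K
    rw [h0, map_zero]
  rw [this, map_zero] at h
  exact lt_irrefl _ h

theorem IsPos.ne_zero {z : K} (h : IsPos z) : z ≠ 0 := by
  obtain ⟨p, q, hp, hq, e⟩ := h
  rintro rfl
  rw [zero_mul] at e
  exact map_ne_zero_of_pos hp e.symm

theorem IsPos.next {a b d : K} {r : ℕ} (ha : IsPos a) (hb : IsPos b)
    (h : a * d = b ^ r + 1) : IsPos d := by
  have ha0 := ha.ne_zero
  obtain ⟨p, q, hp, hq, e⟩ := ha
  obtain ⟨p', q', hp', hq', e'⟩ := hb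
  refine ⟨q * (p' ^ r + q' ^ r), p * q' ^ r, ?_, ?_, ?_⟩
  · simp only [map_mul, map_add, map_pow]
    positivity
  · simp only [map_mul, map_pow]
    positivity
  · simp only [map_mul, map_add, map_pow]
    rw [← e, ← e', mul_pow]
    linear_combination (algebraMap (MvPolynomial (Fin 2) ℚ) K q *
      (algebraMap (MvPolynomial (Fin 2) ℚ) K q') ^ r) * h

theorem main_aux {r : ℕ} (hr : 2 ≤ r) (Y : ℕ → K) (hY : ∀ k, Y k ≠ 0)
    (hrec : ∀ k, Y k * Y (k + 2) = Y (k + 1) ^ r + 1) {n : ℕ} (hn : 2 ≤ n) :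
    ∀ k, Y (k + n + 1) = Phi r n (Y k) (Y (k + 1)) := by
  induction n, hn using Nat.le_induction with
  | base =>
    intro k
    exact (Phi_base hr (hY k) (hY (k + 1)) (hrec k) (hrec (k + 1))).symm
  | succ n hn ih =>
    intro k
    rw [Phi_step hr hn (hY k) (hY (k + 1)) (hY (k + 2)) (hrec k), ← ih (k + 1)]
    congr 1
    omega

theorem cluster_expansion_formula_neg (r : ℕ) (hr : 2 ≤ r) (X : ℤ → K)
    (hX1 : X 1 = x₁) (hX2 : X 2 = x₂)
    (hrec : ∀ m : ℤ, X (m + 1) * X (m - 1) = X m ^ r + 1)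
    (n : ℕ) (hn : 4 ≤ n) :
    X (3 - (n : ℤ)) = x₂ ^ (-(c r (n - 1))) * x₁ ^ (-(c r (n - 2))) *
      ∑ᶠ β ∈ FD r n,
        x₂ ^ ((r : ℤ) * (B1 β : ℤ)) * x₁ ^ ((r : ℤ) * (c r (n - 1) - (B2 r n β : ℤ))) := by
  obtain ⟨n, rfl⟩ : ∃ m, n = m + 2 := ⟨n - 2, by omega⟩
  have hn' : 2 ≤ n := by omega
  have hYrec : ∀ k : ℕ, X (2 - (k : ℤ)) * X (2 - ((k + 2 : ℕ) : ℤ)) =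
      X (2 - ((k + 1 : ℕ) : ℤ)) ^ r + 1 := by
    intro k
    rw [← hrec]
    congr 2 <;> push_cast <;> ring
  have hpos : ∀ k : ℕ, IsPos (X (2 - (k : ℤ))) ∧ IsPos (X (2 - ((k + 1 : ℕ) : ℤ))) := by
    intro k
    induction k with
    | zero =>
      constructor
      · rw [Nat.cast_zero, sub_zero, hX2]
        exact ⟨MvPolynomial.X 1, 1, by simp, by simp, by simp [x₂]⟩
      · rw [zero_add, Nat.cast_one, show (2 : ℤ) - 1 = 1 by norm_num, hX1]
        exact ⟨MvPolynomial.X 0, 1, by simp, by simp, by simp [x₁]⟩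
    | succ k ih => exact ⟨ih.2, ih.1.next ih.2 (hYrec k)⟩
  have key := main_aux hr (fun k : ℕ => X (2 - (k : ℤ))) (fun k => (hpos k).1.ne_zero)
    hYrec hn' 0
  simp only [zero_add, Nat.cast_zero, sub_zero, Nat.cast_one,
    show (2 : ℤ) - 1 = 1 by norm_num, hX1, hX2] at key
  have e1 : (3 : ℤ) - ((n + 2 : ℕ) : ℤ) = 2 - ((n + 1 : ℕ) : ℤ) := by push_cast; ring
  rw [e1, key]
  unfold Phi
  rw [show n + 2 - 1 = n + 1 from rfl, show n + 2 - 2 = n from rfl]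
  congr 1
  exact (finsum_FD hr hn' (fun s t => x₂ ^ ((r : ℤ) * (s : ℤ)) *
    x₁ ^ ((r : ℤ) * (c r (n + 1) - (t : ℤ))))).symm

end CF
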